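/- Let C₀, M > 0. There exists a constant C₄ > 0, depending only on L, T, C₀, M (and not on ε), such that for every ε ∈ (0,1) and every classical solution u of the regularized problem (2.9) whose smooth data satisfy C₀⁻¹(1−y) ≤ u₀^ε, u₁^ε ≤ C₀(1−y), v₀^ε ≤ 0, with the C²-norms of u₀^ε, u₁^ε, v₀^ε, U, P bounded by M and U ≥ M⁻¹, and which satisfies C₁⁻¹(1−y) ≤ u ≤ C₁(1−y) on Q_T for some C₁ ≤ M, one has sup_{0 ≤ t ≤ T} ∫₀^L ∫₀^1 ( |∂_x u(x,y,t)| + |∂_t u(x,y,t)| ) dx dy ≤ C₄. -/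

import Mathlib

open Real Set MeasureTheory

noncomputable section

/-- Partial derivative in the first variable of a two-variable function. -/
def pd1 (f : ℝ → ℝ → ℝ) (x t : ℝ) : ℝ := deriv (fun x' => f x' t) x

/-- Partial derivative in the second variable of a two-variable function. -/
def pd2 (f : ℝ → ℝ → ℝ) (x t : ℝ) : ℝ := deriv (fun t' => f x t') t

/-- Partial derivatives of a function of `(x, y, t)`. -/
def Dx (u : ℝ → ℝ → ℝ → ℝ) (x y t : ℝ) : ℝ := deriv (fun s => u s y t) x
def Dy (u : ℝ → ℝ → ℝ → ℝ) (x y t : ℝ) : ℝ := deriv (fun s => u x s t) y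
def Dt (u : ℝ → ℝ → ℝ → ℝ) (x y t : ℝ) : ℝ := deriv (fun s => u x y s) t
def Dyy (u : ℝ → ℝ → ℝ → ℝ) (x y t : ℝ) : ℝ := iteratedDeriv 2 (fun s => u x s t) y

/-- The coefficient `b = (1-y²)∂ₓU + (1-y)∂ₜU/U`. -/
def bcoef (U : ℝ → ℝ → ℝ) (x y t : ℝ) : ℝ :=
  (1 - y ^ 2) * pd1 U x t + (1 - y) * pd2 U x t / U x t

/-- The coefficient `c = (1-y)∂ₓU - ∂ₓP/U`. -/
def ccoef (U P : ℝ → ℝ → ℝ) (x y t : ℝ) : ℝ :=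
  (1 - y) * pd1 U x t - pd1 P x t / U x t

def Smooth2 (f : ℝ → ℝ → ℝ) : Prop := ContDiff ℝ (⊤ : ℕ∞) (fun p : ℝ × ℝ => f p.1 p.2)
def Smooth3 (u : ℝ → ℝ → ℝ → ℝ) : Prop :=
  ContDiff ℝ (⊤ : ℕ∞) (fun p : ℝ × ℝ × ℝ => u p.1 p.2.1 p.2.2)

/-- `C²`-norm of `f` bounded by `M` on `s₁ × s₂`. -/
def C2Bound (f : ℝ → ℝ → ℝ) (s₁ s₂ : Set ℝ) (M : ℝ) : Prop :=
  ∀ x ∈ s₁, ∀ t ∈ s₂,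
    |f x t| ≤ M ∧ |pd1 f x t| ≤ M ∧ |pd2 f x t| ≤ M ∧
    |pd1 (pd1 f) x t| ≤ M ∧ |pd2 (pd2 f) x t| ≤ M ∧ |pd2 (pd1 f) x t| ≤ M

/-- Background Euler flow data: smooth `U > 0`, `P`, Bernoulli law, favorable pressure,
`C²`-norms bounded by `M` and `U ≥ M⁻¹`. -/
def EulerData (L T M : ℝ) (U P : ℝ → ℝ → ℝ) : Prop :=
  Smooth2 U ∧ Smooth2 P ∧
  (∀ x ∈ Icc 0 L, ∀ t ∈ Icc 0 T, 0 < U x t) ∧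
  (∀ x ∈ Icc 0 L, ∀ t ∈ Icc 0 T, pd2 U x t + U x t * pd1 U x t + pd1 P x t = 0) ∧
  (∀ x ∈ Icc 0 L, ∀ t ∈ Icc 0 T, pd1 P x t ≤ 0) ∧
  C2Bound U (Icc 0 L) (Icc 0 T) M ∧ C2Bound P (Icc 0 L) (Icc 0 T) M ∧
  (∀ x ∈ Icc 0 L, ∀ t ∈ Icc 0 T, M⁻¹ ≤ U x t)

/-- Classical solution of the regularized problem (2.9). -/
def RegSolution (L T ε : ℝ) (U P : ℝ → ℝ → ℝ)
    (u₀ u₁ v₀ : ℝ → ℝ → ℝ) (u : ℝ → ℝ → ℝ → ℝ) : Prop :=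
  Smooth3 u ∧
  (∀ x ∈ Ioo 0 L, ∀ y ∈ Ioo (0:ℝ) 1, ∀ t ∈ Ioo 0 T,
    Dt u x y t - (u x y t + ε) ^ 2 * Dyy u x y t + (y * U x t + ε) * Dx u x y t
      + bcoef U x y t * Dy u x y t + ccoef U P x y t * u x y t = 0) ∧
  (∀ x ∈ Icc 0 L, ∀ y ∈ Icc (0:ℝ) 1, u x y 0 = u₀ x y) ∧
  (∀ y ∈ Icc (0:ℝ) 1, ∀ t ∈ Icc 0 T, u 0 y t = u₁ y t) ∧
  (∀ x ∈ Icc 0 L, ∀ t ∈ Icc 0 T, u x 1 t = 0) ∧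
  (∀ x ∈ Icc 0 L, ∀ t ∈ Icc 0 T,
    (u x 0 t + ε) * Dy u x 0 t = v₀ x t * (u x 0 t + ε) + pd1 P x t / U x t)

/-- The data bounds: smooth nonnegative data with `C₀⁻¹(1-y) ≤ u₀, u₁ ≤ C₀(1-y)`, `v₀ ≤ 0`. -/
def DataBounds (L T C₀ : ℝ) (u₀ u₁ v₀ : ℝ → ℝ → ℝ) : Prop :=
  Smooth2 u₀ ∧ Smooth2 u₁ ∧ Smooth2 v₀ ∧
  (∀ x ∈ Icc 0 L, ∀ y ∈ Icc (0:ℝ) 1,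
    C₀⁻¹ * (1 - y) ≤ u₀ x y ∧ u₀ x y ≤ C₀ * (1 - y)) ∧
  (∀ y ∈ Icc (0:ℝ) 1, ∀ t ∈ Icc 0 T,
    C₀⁻¹ * (1 - y) ≤ u₁ y t ∧ u₁ y t ≤ C₀ * (1 - y)) ∧
  (∀ x ∈ Icc 0 L, ∀ t ∈ Icc 0 T, v₀ x t ≤ 0)

/-- The parabolic cylinder `Q_T = (0,L) × (0,1) × (0,T)`. -/
def QT (L T : ℝ) : Set (ℝ × ℝ × ℝ) := (Ioo 0 L) ×ˢ ((Ioo (0:ℝ) 1) ×ˢ (Ioo 0 T))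

open scoped ContDiff Topology

/-- Smoothness on a set of a function of `(x, y, t)` in curried form. -/
def SmoothOn (Ω : Set (ℝ × ℝ × ℝ)) (f : ℝ → ℝ → ℝ → ℝ) : Prop :=
  ContDiffOn ℝ ∞ (fun q : ℝ × ℝ × ℝ => f q.1 q.2.1 q.2.2) Ω

namespace SmoothOn

variable {Ω : Set (ℝ × ℝ × ℝ)} {f g : ℝ → ℝ → ℝ → ℝ}

lemma continuousOn (hf : SmoothOn Ω f) :
    ContinuousOn (fun q : ℝ × ℝ × ℝ => f q.1 q.2.1 q.2.2) Ω :=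
  ContDiffOn.continuousOn hf

lemma add (hf : SmoothOn Ω f) (hg : SmoothOn Ω g) :
    SmoothOn Ω (fun x y t => f x y t + g x y t) := ContDiffOn.add hf hg

lemma sub (hf : SmoothOn Ω f) (hg : SmoothOn Ω g) :
    SmoothOn Ω (fun x y t => f x y t - g x y t) := ContDiffOn.sub hf hg

lemma mul (hf : SmoothOn Ω f) (hg : SmoothOn Ω g) :
    SmoothOn Ω (fun x y t => f x y t * g x y t) := ContDiffOn.mul hf hg

lemma div (hf : SmoothOn Ω f) (hg : SmoothOn Ω g)
    (h : ∀ q ∈ Ω, g q.1 q.2.1 q.2.2 ≠ 0) :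
    SmoothOn Ω (fun x y t => f x y t / g x y t) := ContDiffOn.div hf hg h

lemma pow (hf : SmoothOn Ω f) (n : ℕ) :
    SmoothOn Ω (fun x y t => f x y t ^ n) := ContDiffOn.pow hf n

lemma sqrt (hf : SmoothOn Ω f) (h : ∀ q ∈ Ω, f q.1 q.2.1 q.2.2 ≠ 0) :
    SmoothOn Ω (fun x y t => √(f x y t)) := ContDiffOn.sqrt hf h

lemma const (c : ℝ) : SmoothOn Ω (fun _ _ _ => c) := contDiffOn_const

lemma of_contDiff (hf : ContDiff ℝ ∞ (fun q : ℝ × ℝ × ℝ => f q.1 q.2.1 q.2.2)) :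
    SmoothOn Ω f := hf.contDiffOn

lemma differentiableAt (hf : SmoothOn Ω f) (hΩ : IsOpen Ω) {x y t : ℝ} (h : (x, y, t) ∈ Ω) :
    DifferentiableAt ℝ (fun q : ℝ × ℝ × ℝ => f q.1 q.2.1 q.2.2) (x, y, t) :=
  (ContDiffOn.contDiffAt hf (hΩ.mem_nhds h)).differentiableAt (by simp)

lemma hasDerivAt_x_fderiv (hf : SmoothOn Ω f) (hΩ : IsOpen Ω) {x y t : ℝ} (h : (x, y, t) ∈ Ω) :
    HasDerivAt (fun s => f s y t)
      (fderiv ℝ (fun q : ℝ × ℝ × ℝ => f q.1 q.2.1 q.2.2) (x, y, t) (1, 0, 0)) x := by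
  have h1 : HasDerivAt (fun s : ℝ => (s, y, t)) ((1 : ℝ), (0 : ℝ), (0 : ℝ)) x :=
    (hasDerivAt_id x).prodMk ((hasDerivAt_const x y).prodMk (hasDerivAt_const x t))
  exact (hf.differentiableAt hΩ h).hasFDerivAt.comp_hasDerivAt x h1

lemma hasDerivAt_y_fderiv (hf : SmoothOn Ω f) (hΩ : IsOpen Ω) {x y t : ℝ} (h : (x, y, t) ∈ Ω) :
    HasDerivAt (fun s => f x s t)
      (fderiv ℝ (fun q : ℝ × ℝ × ℝ => f q.1 q.2.1 q.2.2) (x, y, t) (0, 1, 0)) y := by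
  have h1 : HasDerivAt (fun s : ℝ => (x, s, t)) ((0 : ℝ), (1 : ℝ), (0 : ℝ)) y :=
    (hasDerivAt_const y x).prodMk ((hasDerivAt_id y).prodMk (hasDerivAt_const y t))
  exact (hf.differentiableAt hΩ h).hasFDerivAt.comp_hasDerivAt y h1

lemma hasDerivAt_t_fderiv (hf : SmoothOn Ω f) (hΩ : IsOpen Ω) {x y t : ℝ} (h : (x, y, t) ∈ Ω) :
    HasDerivAt (fun s => f x y s)
      (fderiv ℝ (fun q : ℝ × ℝ × ℝ => f q.1 q.2.1 q.2.2) (x, y, t) (0, 0, 1)) t := by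
  have h1 : HasDerivAt (fun s : ℝ => (x, y, s)) ((0 : ℝ), (0 : ℝ), (1 : ℝ)) t :=
    (hasDerivAt_const t x).prodMk ((hasDerivAt_const t y).prodMk (hasDerivAt_id t))
  exact (hf.differentiableAt hΩ h).hasFDerivAt.comp_hasDerivAt t h1

lemma hasDerivAt_x (hf : SmoothOn Ω f) (hΩ : IsOpen Ω) {x y t : ℝ} (h : (x, y, t) ∈ Ω) :
    HasDerivAt (fun s => f s y t) (Dx f x y t) x :=
  (hf.hasDerivAt_x_fderiv hΩ h).differentiableAt.hasDerivAt

lemma hasDerivAt_y (hf : SmoothOn Ω f) (hΩ : IsOpen Ω) {x y t : ℝ} (h : (x, y, t) ∈ Ω) :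
    HasDerivAt (fun s => f x s t) (Dy f x y t) y :=
  (hf.hasDerivAt_y_fderiv hΩ h).differentiableAt.hasDerivAt

lemma hasDerivAt_t (hf : SmoothOn Ω f) (hΩ : IsOpen Ω) {x y t : ℝ} (h : (x, y, t) ∈ Ω) :
    HasDerivAt (fun s => f x y s) (Dt f x y t) t :=
  (hf.hasDerivAt_t_fderiv hΩ h).differentiableAt.hasDerivAt

lemma dx_eq (hf : SmoothOn Ω f) (hΩ : IsOpen Ω) {q : ℝ × ℝ × ℝ} (h : q ∈ Ω) :
    Dx f q.1 q.2.1 q.2.2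
      = fderiv ℝ (fun q : ℝ × ℝ × ℝ => f q.1 q.2.1 q.2.2) q (1, 0, 0) :=
  (hf.hasDerivAt_x_fderiv hΩ h).deriv

lemma dy_eq (hf : SmoothOn Ω f) (hΩ : IsOpen Ω) {q : ℝ × ℝ × ℝ} (h : q ∈ Ω) :
    Dy f q.1 q.2.1 q.2.2
      = fderiv ℝ (fun q : ℝ × ℝ × ℝ => f q.1 q.2.1 q.2.2) q (0, 1, 0) :=
  (hf.hasDerivAt_y_fderiv hΩ h).deriv

lemma dt_eq (hf : SmoothOn Ω f) (hΩ : IsOpen Ω) {q : ℝ × ℝ × ℝ} (h : q ∈ Ω) :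
    Dt f q.1 q.2.1 q.2.2
      = fderiv ℝ (fun q : ℝ × ℝ × ℝ => f q.1 q.2.1 q.2.2) q (0, 0, 1) :=
  (hf.hasDerivAt_t_fderiv hΩ h).deriv

lemma fderiv_apply (hf : SmoothOn Ω f) (hΩ : IsOpen Ω) (v : ℝ × ℝ × ℝ) :
    ContDiffOn ℝ ∞ (fun q => fderiv ℝ (fun q : ℝ × ℝ × ℝ => f q.1 q.2.1 q.2.2) q v) Ω :=
  (ContDiffOn.fderiv_of_isOpen hf hΩ (by simp)).clm_apply contDiffOn_const

lemma dx (hf : SmoothOn Ω f) (hΩ : IsOpen Ω) : SmoothOn Ω (Dx f) :=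
  (hf.fderiv_apply hΩ (1, 0, 0)).congr fun _ h => hf.dx_eq hΩ h

lemma dy (hf : SmoothOn Ω f) (hΩ : IsOpen Ω) : SmoothOn Ω (Dy f) :=
  (hf.fderiv_apply hΩ (0, 1, 0)).congr fun _ h => hf.dy_eq hΩ h

lemma dt (hf : SmoothOn Ω f) (hΩ : IsOpen Ω) : SmoothOn Ω (Dt f) :=
  (hf.fderiv_apply hΩ (0, 0, 1)).congr fun _ h => hf.dt_eq hΩ h

lemma fderiv_fderiv_comm (hf : SmoothOn Ω f) (hΩ : IsOpen Ω) {q : ℝ × ℝ × ℝ} (h : q ∈ Ω)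
    (v w : ℝ × ℝ × ℝ) :
    fderiv ℝ (fun q => fderiv ℝ (fun q : ℝ × ℝ × ℝ => f q.1 q.2.1 q.2.2) q v) q w
      = fderiv ℝ (fun q => fderiv ℝ (fun q : ℝ × ℝ × ℝ => f q.1 q.2.1 q.2.2) q w) q v := by
  have hs : ContDiffAt ℝ ∞ (fun q : ℝ × ℝ × ℝ => f q.1 q.2.1 q.2.2) q :=
    ContDiffOn.contDiffAt hf (hΩ.mem_nhds h)
  have hsymm := hs.isSymmSndFDerivAt (by
    rw [minSmoothness_of_isRCLikeNormedField]; exact WithTop.coe_le_coe.2 le_top)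
  have hd : DifferentiableAt ℝ (fderiv ℝ (fun q : ℝ × ℝ × ℝ => f q.1 q.2.1 q.2.2)) q :=
    ((ContDiffOn.fderiv_of_isOpen (m := ∞) hf hΩ (by simp)).contDiffAt
      (hΩ.mem_nhds h)).differentiableAt (by simp)
  rw [fderiv_clm_apply hd (differentiableAt_const v),
    fderiv_clm_apply hd (differentiableAt_const w)]
  simpa using hsymm w v

lemma dt_dx_comm (hf : SmoothOn Ω f) (hΩ : IsOpen Ω) {x y t : ℝ} (h : (x, y, t) ∈ Ω) :
    Dt (Dx f) x y t = Dx (Dt f) x y t := by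
  rw [(hf.dx hΩ).dt_eq hΩ h, (hf.dt hΩ).dx_eq hΩ h]
  have e1 : (fun q : ℝ × ℝ × ℝ => Dx f q.1 q.2.1 q.2.2) =ᶠ[𝓝 (x, y, t)] _ :=
    Filter.eventually_of_mem (hΩ.mem_nhds h) fun _ hq => hf.dx_eq hΩ hq
  have e2 : (fun q : ℝ × ℝ × ℝ => Dt f q.1 q.2.1 q.2.2) =ᶠ[𝓝 (x, y, t)] _ :=
    Filter.eventually_of_mem (hΩ.mem_nhds h) fun _ hq => hf.dt_eq hΩ hq
  rw [e1.fderiv_eq, e2.fderiv_eq, hf.fderiv_fderiv_comm hΩ h]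

lemma dy_dx_comm (hf : SmoothOn Ω f) (hΩ : IsOpen Ω) {x y t : ℝ} (h : (x, y, t) ∈ Ω) :
    Dy (Dx f) x y t = Dx (Dy f) x y t := by
  rw [(hf.dx hΩ).dy_eq hΩ h, (hf.dy hΩ).dx_eq hΩ h]
  have e1 : (fun q : ℝ × ℝ × ℝ => Dx f q.1 q.2.1 q.2.2) =ᶠ[𝓝 (x, y, t)] _ :=
    Filter.eventually_of_mem (hΩ.mem_nhds h) fun _ hq => hf.dx_eq hΩ hq
  have e2 : (fun q : ℝ × ℝ × ℝ => Dy f q.1 q.2.1 q.2.2) =ᶠ[𝓝 (x, y, t)] _ :=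
    Filter.eventually_of_mem (hΩ.mem_nhds h) fun _ hq => hf.dy_eq hΩ hq
  rw [e1.fderiv_eq, e2.fderiv_eq, hf.fderiv_fderiv_comm hΩ h]

lemma dy_dt_comm (hf : SmoothOn Ω f) (hΩ : IsOpen Ω) {x y t : ℝ} (h : (x, y, t) ∈ Ω) :
    Dy (Dt f) x y t = Dt (Dy f) x y t := by
  rw [(hf.dt hΩ).dy_eq hΩ h, (hf.dy hΩ).dt_eq hΩ h]
  have e1 : (fun q : ℝ × ℝ × ℝ => Dt f q.1 q.2.1 q.2.2) =ᶠ[𝓝 (x, y, t)] _ :=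
    Filter.eventually_of_mem (hΩ.mem_nhds h) fun _ hq => hf.dt_eq hΩ hq
  have e2 : (fun q : ℝ × ℝ × ℝ => Dy f q.1 q.2.1 q.2.2) =ᶠ[𝓝 (x, y, t)] _ :=
    Filter.eventually_of_mem (hΩ.mem_nhds h) fun _ hq => hf.dy_eq hΩ hq
  rw [e1.fderiv_eq, e2.fderiv_eq, hf.fderiv_fderiv_comm hΩ h]

end SmoothOn

/-- The closed parabolic cylinder `[0,L] × [0,1] × [0,T]`. -/
def closedBox (L T : ℝ) : Set (ℝ × ℝ × ℝ) := Icc 0 L ×ˢ Icc (0:ℝ) 1 ×ˢ Icc 0 T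

lemma closure_QT {L T : ℝ} (hL : 0 < L) (hT : 0 < T) : closure (QT L T) = closedBox L T := by
  rw [QT, closure_prod_eq, closure_prod_eq, closure_Ioo hL.ne, closure_Ioo zero_ne_one,
    closure_Ioo hT.ne, closedBox]

lemma QT_subset_closedBox {L T : ℝ} : QT L T ⊆ closedBox L T :=
  prod_mono Ioo_subset_Icc_self (prod_mono Ioo_subset_Icc_self Ioo_subset_Icc_self)

/-- A non-strict inequality between smooth functions extends from the open cylinder to the
closed one. -/
lemma SmoothOn.le_on_closedBox {L T : ℝ} (hL : 0 < L) (hT : 0 < T) {Ω : Set (ℝ × ℝ × ℝ)}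
    (hΩ : closedBox L T ⊆ Ω) {f g : ℝ → ℝ → ℝ → ℝ} (hf : SmoothOn Ω f) (hg : SmoothOn Ω g)
    (h : ∀ x ∈ Ioo 0 L, ∀ y ∈ Ioo (0:ℝ) 1, ∀ t ∈ Ioo 0 T, f x y t ≤ g x y t) :
    ∀ x ∈ Icc 0 L, ∀ y ∈ Icc (0:ℝ) 1, ∀ t ∈ Icc 0 T, f x y t ≤ g x y t := by
  intro x hx y hy t ht
  have hmem : (x, y, t) ∈ closedBox L T := ⟨hx, hy, ht⟩
  have hcl : (x, y, t) ∈ closure (QT L T) := by rwa [closure_QT hL hT]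
  exact ContinuousWithinAt.closure_le (f := fun q : ℝ × ℝ × ℝ => f q.1 q.2.1 q.2.2)
    (g := fun q : ℝ × ℝ × ℝ => g q.1 q.2.1 q.2.2) hcl
    ((hf.continuousOn _ (hΩ hmem)).mono (QT_subset_closedBox.trans hΩ))
    ((hg.continuousOn _ (hΩ hmem)).mono (QT_subset_closedBox.trans hΩ))
    fun q hq => h q.1 hq.1 q.2.1 hq.2.1 q.2.2 hq.2.2

/-- The nearest-point projection of `ℝ³` onto the closed cylinder. -/
def clamp (L T : ℝ) (q : ℝ × ℝ × ℝ) : ℝ × ℝ × ℝ :=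
  (max 0 (min q.1 L), max 0 (min q.2.1 1), max 0 (min q.2.2 T))

lemma continuous_clamp (L T : ℝ) : Continuous (clamp L T) := by
  unfold clamp; fun_prop

lemma clamp_mem {L T : ℝ} (hL : 0 ≤ L) (hT : 0 ≤ T) (q : ℝ × ℝ × ℝ) :
    clamp L T q ∈ closedBox L T := by
  refine ⟨⟨?_, ?_⟩, ⟨?_, ?_⟩, ⟨?_, ?_⟩⟩ <;> simp [clamp, hL, hT]

lemma clamp_of_mem {L T : ℝ} {q : ℝ × ℝ × ℝ} (h : q ∈ closedBox L T) : clamp L T q = q := by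
  obtain ⟨⟨h1, h2⟩, ⟨h3, h4⟩, ⟨h5, h6⟩⟩ := h
  simp [clamp, h1, h2, h3, h4, h5, h6]

lemma exists_continuous_eqOn_closedBox {L T : ℝ} (hL : 0 ≤ L) (hT : 0 ≤ T)
    {f : ℝ → ℝ → ℝ → ℝ}
    (hf : ContinuousOn (fun q : ℝ × ℝ × ℝ => f q.1 q.2.1 q.2.2) (closedBox L T)) :
    ∃ g : ℝ → ℝ → ℝ → ℝ, Continuous (fun q : ℝ × ℝ × ℝ => g q.1 q.2.1 q.2.2) ∧
      ∀ x ∈ Icc 0 L, ∀ y ∈ Icc (0:ℝ) 1, ∀ t ∈ Icc 0 T, g x y t = f x y t := by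
  refine ⟨fun x y t => (fun q : ℝ × ℝ × ℝ => f q.1 q.2.1 q.2.2) (clamp L T (x, y, t)), ?_, ?_⟩
  · exact hf.comp_continuous (continuous_clamp L T) (clamp_mem hL hT)
  · intro x hx y hy t ht
    simp only [clamp_of_mem (show (x, y, t) ∈ closedBox L T from ⟨hx, hy, ht⟩)]

lemma intervalIntegral_swap_of_continuous {f : ℝ → ℝ → ℝ}
    (hf : Continuous (fun q : ℝ × ℝ => f q.1 q.2)) (a b c d : ℝ) :
    ∫ x in a..b, ∫ y in c..d, f x y = ∫ y in c..d, ∫ x in a..b, f x y := by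
  apply MeasureTheory.intervalIntegral_intervalIntegral_swap
  have h : IntegrableOn (fun q : ℝ × ℝ => f q.1 q.2) (uIcc a b ×ˢ uIcc c d) :=
    hf.continuousOn.integrableOn_compact (isCompact_uIcc.prod isCompact_uIcc)
  exact h.mono_set (prod_mono uIoc_subset_uIcc uIoc_subset_uIcc)

lemma mul_sub_le_integral {f : ℝ → ℝ} (hf : Continuous f) {a b c : ℝ} (hab : a ≤ b)
    (h : ∀ x ∈ Icc a b, c ≤ f x) : c * (b - a) ≤ ∫ x in a..b, f x := by
  have := intervalIntegral.integral_mono_on (f := fun _ => c) hab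
    (intervalIntegrable_const (μ := volume)) (hf.intervalIntegrable a b) h
  simpa [mul_comm] using this

lemma integral_le_mul_sub {f : ℝ → ℝ} (hf : Continuous f) {a b c : ℝ} (hab : a ≤ b)
    (h : ∀ x ∈ Icc a b, f x ≤ c) : ∫ x in a..b, f x ≤ c * (b - a) := by
  have := intervalIntegral.integral_mono_on (g := fun _ => c) hab
    (hf.intervalIntegrable (μ := volume) a b) intervalIntegrable_const h
  simpa [mul_comm] using this

lemma integral_add_add {f g h : ℝ → ℝ} (hf : Continuous f) (hg : Continuous g)
    (hh : Continuous h) (a b : ℝ) :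
    ∫ x in a..b, (f x + (g x + h x))
      = (∫ x in a..b, f x) + ((∫ x in a..b, g x) + ∫ x in a..b, h x) := by
  rw [← intervalIntegral.integral_add (hg.intervalIntegrable a b) (hh.intervalIntegrable a b),
    ← intervalIntegral.integral_add (hf.intervalIntegrable a b)
      ((hg.intervalIntegrable a b).add (hh.intervalIntegrable a b))]

/-- Integrated form of the differential inequality `∂ₜΦ + ∂ₓF + ∂_yG ≤ B`. -/
lemma integral_le_of_divergence_le {L T B : ℝ} (hL : 0 < L) (hT : 0 < T) (hB : 0 ≤ B)
    {Ω : Set (ℝ × ℝ × ℝ)} (hΩ : IsOpen Ω) (hsub : closedBox L T ⊆ Ω)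
    {Φ F G : ℝ → ℝ → ℝ → ℝ} (hΦ : SmoothOn Ω Φ) (hF : SmoothOn Ω F) (hG : SmoothOn Ω G)
    (hdiv : ∀ x ∈ Ioo 0 L, ∀ y ∈ Ioo (0:ℝ) 1, ∀ t ∈ Ioo 0 T,
      Dt Φ x y t + Dx F x y t + Dy G x y t ≤ B)
    (hFx : ∀ y ∈ Icc (0:ℝ) 1, ∀ t ∈ Icc 0 T, F 0 y t - F L y t ≤ B)
    (hGy : ∀ x ∈ Icc 0 L, ∀ t ∈ Icc 0 T, G x 0 t - G x 1 t ≤ B)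
    (hinit : ∀ x ∈ Icc 0 L, ∀ y ∈ Icc (0:ℝ) 1, Φ x y 0 ≤ B) :
    ∀ t ∈ Icc 0 T, ∫ x in 0..L, ∫ y in 0..1, Φ x y t ≤ B * (1 + T) * L + B * T * L + B * T := by
  intro t ht
  have hdiv' := SmoothOn.le_on_closedBox hL hT hsub
    (((hΦ.dt hΩ).add (hF.dx hΩ)).add (hG.dy hΩ)) (SmoothOn.const B) hdiv
  obtain ⟨a, hac, ha⟩ := exists_continuous_eqOn_closedBox hL.le hT.le
    ((hΦ.dt hΩ).continuousOn.mono hsub)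
  obtain ⟨f, hfc, hf⟩ := exists_continuous_eqOn_closedBox hL.le hT.le
    ((hF.dx hΩ).continuousOn.mono hsub)
  obtain ⟨g, hgc, hg⟩ := exists_continuous_eqOn_closedBox hL.le hT.le
    ((hG.dy hΩ).continuousOn.mono hsub)
  obtain ⟨φ, hφc, hφ⟩ := exists_continuous_eqOn_closedBox hL.le hT.le
    (hΦ.continuousOn.mono hsub)
  have hmem : ∀ {x y s : ℝ}, x ∈ Icc 0 L → y ∈ Icc (0:ℝ) 1 → s ∈ Icc 0 T → (x, y, s) ∈ Ω :=
    fun hx hy hs => hsub ⟨hx, hy, hs⟩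
  have ht0 : (0:ℝ) ≤ t := ht.1
  have hst : ∀ {s}, s ∈ Icc 0 t → s ∈ Icc 0 T := fun hs => ⟨hs.1, hs.2.trans ht.2⟩
  have h0T : (0:ℝ) ∈ Icc 0 T := ⟨le_rfl, hT.le⟩
  have ca : ∀ x y, Continuous (a x y) := fun x y =>
    hac.comp (f := fun s : ℝ => (x, y, s)) (by fun_prop)
  have cf : ∀ x y, Continuous (f x y) := fun x y =>
    hfc.comp (f := fun s : ℝ => (x, y, s)) (by fun_prop)
  have cg : ∀ x y, Continuous (g x y) := fun x y =>
    hgc.comp (f := fun s : ℝ => (x, y, s)) (by fun_prop)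
  have cfI : Continuous (fun q : ℝ × ℝ => ∫ s in 0..t, f q.1 q.2 s) :=
    intervalIntegral.continuous_parametric_intervalIntegral_of_continuous'
      (f := fun (q : ℝ × ℝ) s => f q.1 q.2 s)
      (hfc.comp (f := fun p : (ℝ × ℝ) × ℝ => (p.1.1, p.1.2, p.2)) (by fun_prop)) 0 t
  have cgI : Continuous (fun q : ℝ × ℝ => ∫ s in 0..t, g q.1 q.2 s) :=
    intervalIntegral.continuous_parametric_intervalIntegral_of_continuous'
      (f := fun (q : ℝ × ℝ) s => g q.1 q.2 s)
      (hgc.comp (f := fun p : (ℝ × ℝ) × ℝ => (p.1.1, p.1.2, p.2)) (by fun_prop)) 0 t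
  have cφ : Continuous (fun q : ℝ × ℝ => φ q.1 q.2 t) :=
    hφc.comp (f := fun q : ℝ × ℝ => (q.1, q.2, t)) (by fun_prop)
  have csec : ∀ {h : ℝ × ℝ → ℝ}, Continuous h → ∀ x, Continuous (fun y => h (x, y)) :=
    fun hc x => hc.comp (f := fun y : ℝ => (x, y)) (by fun_prop)
  have cint : ∀ {h : ℝ × ℝ → ℝ}, Continuous h → Continuous (fun x => ∫ y in (0:ℝ)..1, h (x, y)) :=
    fun {h} hc => intervalIntegral.continuous_parametric_intervalIntegral_of_continuous'
      (f := fun x y => h (x, y)) hc 0 1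
  have key : ∀ x ∈ Icc 0 L, ∀ y ∈ Icc (0:ℝ) 1,
      φ x y t + ((∫ s in 0..t, f x y s) + ∫ s in 0..t, g x y s) ≤ B * (1 + T) := by
    intro x hx y hy
    have e1 : ∫ s in 0..t, a x y s = Φ x y t - Φ x y 0 := by
      rw [← intervalIntegral.integral_eq_sub_of_hasDerivAt (f := fun s => Φ x y s) (f' := a x y)
        _ ((ca x y).intervalIntegrable 0 t)]
      intro s hs
      rw [uIcc_of_le ht0] at hs
      rw [ha x hx y hy s (hst hs)]
      exact hΦ.hasDerivAt_t hΩ (hmem hx hy (hst hs))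
    have e2 : ∫ s in 0..t, (a x y s + (f x y s + g x y s)) ≤ B * (t - 0) := by
      refine integral_le_mul_sub ((ca x y).add ((cf x y).add (cg x y))) ht0 fun s hs => ?_
      show a x y s + (f x y s + g x y s) ≤ B
      rw [ha x hx y hy s (hst hs), hf x hx y hy s (hst hs), hg x hx y hy s (hst hs), ← add_assoc]
      exact hdiv' x hx y hy s (hst hs)
    rw [integral_add_add (ca x y) (cf x y) (cg x y), e1] at e2
    rw [hφ x hx y hy t ht]
    nlinarith [hinit x hx y hy, ht.2]
  have hsum : ∫ x in 0..L, ∫ y in (0:ℝ)..1,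
      (φ x y t + ((∫ s in 0..t, f x y s) + ∫ s in 0..t, g x y s)) ≤ B * (1 + T) * (L - 0) := by
    refine integral_le_mul_sub (cint (cφ.add (cfI.add cgI))) hL.le fun x hx => ?_
    have := integral_le_mul_sub (csec (cφ.add (cfI.add cgI)) x) zero_le_one (key x hx)
    simpa using this
  have hsplit : ∫ x in 0..L, ∫ y in (0:ℝ)..1,
      (φ x y t + ((∫ s in 0..t, f x y s) + ∫ s in 0..t, g x y s))
      = (∫ x in 0..L, ∫ y in (0:ℝ)..1, φ x y t)
        + ((∫ x in 0..L, ∫ y in (0:ℝ)..1, ∫ s in 0..t, f x y s)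
        + ∫ x in 0..L, ∫ y in (0:ℝ)..1, ∫ s in 0..t, g x y s) := by
    have i1 : ∀ x, ∫ y in (0:ℝ)..1,
        (φ x y t + ((∫ s in 0..t, f x y s) + ∫ s in 0..t, g x y s))
        = (∫ y in (0:ℝ)..1, φ x y t) + ((∫ y in (0:ℝ)..1, ∫ s in 0..t, f x y s)
          + ∫ y in (0:ℝ)..1, ∫ s in 0..t, g x y s) := by
      exact fun x => integral_add_add (csec cφ x) (csec cfI x) (csec cgI x) 0 1
    simp_rw [i1]
    exact integral_add_add (cint cφ) (cint cfI) (cint cgI) 0 L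
  have hfl : -B * T ≤ ∫ x in 0..L, ∫ y in (0:ℝ)..1, ∫ s in 0..t, f x y s := by
    rw [intervalIntegral_swap_of_continuous cfI]
    have : ∀ y, ∫ x in 0..L, ∫ s in 0..t, f x y s = ∫ s in 0..t, ∫ x in 0..L, f x y s :=
      fun y => intervalIntegral_swap_of_continuous
        (hfc.comp (f := fun q : ℝ × ℝ => (q.1, y, q.2)) (by fun_prop)) _ _ _ _
    have c1 : Continuous (fun y => ∫ x in 0..L, ∫ s in 0..t, f x y s) :=
      intervalIntegral.continuous_parametric_intervalIntegral_of_continuous'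
      (f := fun y x => ∫ s in 0..t, f x y s)
      (cfI.comp (f := fun p : ℝ × ℝ => (p.2, p.1)) (by fun_prop)) 0 L
    have := mul_sub_le_integral (c := -B * T) c1 zero_le_one (fun y hy => by
      rw [this y]
      have c2 : Continuous (fun s => ∫ x in 0..L, f x y s) :=
        intervalIntegral.continuous_parametric_intervalIntegral_of_continuous'
        (f := fun s x => f x y s)
        (hfc.comp (f := fun p : ℝ × ℝ => (p.2, y, p.1)) (by fun_prop)) 0 L
      refine le_trans (b := -B * (t - 0)) (by nlinarith [ht.2])
        (mul_sub_le_integral c2 ht0 fun s hs => ?_)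
      have c3 : Continuous (fun x => f x y s) :=
        hfc.comp (f := fun x : ℝ => (x, y, s)) (by fun_prop)
      rw [intervalIntegral.integral_eq_sub_of_hasDerivAt (f := fun x => F x y s) _
        (c3.intervalIntegrable 0 L)]
      · linarith [hFx y hy s (hst hs)]
      · intro x hx
        rw [uIcc_of_le hL.le] at hx
        rw [hf x hx y hy s (hst hs)]
        exact hF.hasDerivAt_x hΩ (hmem hx hy (hst hs)))
    simpa using this
  have hgl : -B * T * L ≤ ∫ x in 0..L, ∫ y in (0:ℝ)..1, ∫ s in 0..t, g x y s := by
    have := mul_sub_le_integral (c := -B * T) (cint cgI) hL.le (fun x hx => by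
      show _ ≤ ∫ y in (0:ℝ)..1, ∫ s in 0..t, g x y s
      rw [intervalIntegral_swap_of_continuous
        (hgc.comp (f := fun q : ℝ × ℝ => (x, q.1, q.2)) (by fun_prop))]
      have c2 : Continuous (fun s => ∫ y in (0:ℝ)..1, g x y s) :=
        intervalIntegral.continuous_parametric_intervalIntegral_of_continuous'
        (f := fun s y => g x y s)
        (hgc.comp (f := fun p : ℝ × ℝ => (x, p.2, p.1)) (by fun_prop)) 0 1
      refine le_trans (b := -B * (t - 0)) (by nlinarith [ht.2])
        (mul_sub_le_integral c2 ht0 fun s hs => ?_)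
      have c3 : Continuous (fun y => g x y s) :=
        hgc.comp (f := fun y : ℝ => (x, y, s)) (by fun_prop)
      rw [intervalIntegral.integral_eq_sub_of_hasDerivAt (f := fun y => G x y s) _
        (c3.intervalIntegrable 0 1)]
      · linarith [hGy x hx s (hst hs)]
      · intro y hy
        rw [uIcc_of_le zero_le_one] at hy
        rw [hg x hx y hy s (hst hs)]
        exact hG.hasDerivAt_y hΩ (hmem hx hy (hst hs)))
    simpa using this
  have hfin : ∫ x in 0..L, ∫ y in (0:ℝ)..1, Φ x y t = ∫ x in 0..L, ∫ y in (0:ℝ)..1, φ x y t := by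
    refine intervalIntegral.integral_congr fun x hx => intervalIntegral.integral_congr fun y hy => ?_
    rw [uIcc_of_le hL.le] at hx
    rw [uIcc_of_le zero_le_one] at hy
    exact (hφ x hx y hy t ht).symm
  rw [hfin]
  rw [hsplit] at hsum
  linarith

/-- Gronwall form: the differential inequality `∂ₜΦ + ∂ₓF + ∂_yG ≤ kΦ + B`. -/
lemma integral_le_of_divergence_le_mul_add {L T B k : ℝ} (hL : 0 < L) (hT : 0 < T) (hB : 0 ≤ B)
    (hk : 0 ≤ k) {Ω : Set (ℝ × ℝ × ℝ)} (hΩ : IsOpen Ω) (hsub : closedBox L T ⊆ Ω)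
    {Φ F G : ℝ → ℝ → ℝ → ℝ} (hΦ : SmoothOn Ω Φ) (hF : SmoothOn Ω F) (hG : SmoothOn Ω G)
    (hdiv : ∀ x ∈ Ioo 0 L, ∀ y ∈ Ioo (0:ℝ) 1, ∀ t ∈ Ioo 0 T,
      Dt Φ x y t + Dx F x y t + Dy G x y t ≤ k * Φ x y t + B)
    (hFx : ∀ y ∈ Icc (0:ℝ) 1, ∀ t ∈ Icc 0 T, F 0 y t - F L y t ≤ B)
    (hGy : ∀ x ∈ Icc 0 L, ∀ t ∈ Icc 0 T, G x 0 t - G x 1 t ≤ B)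
    (hinit : ∀ x ∈ Icc 0 L, ∀ y ∈ Icc (0:ℝ) 1, Φ x y 0 ≤ B) :
    ∀ t ∈ Icc 0 T, ∫ x in 0..L, ∫ y in 0..1, Φ x y t
      ≤ exp (k * T) * (B * (1 + T) * L + B * T * L + B * T) := by
  intro t ht
  have hE : SmoothOn Ω (fun _ _ s => exp (-k * s)) :=
    SmoothOn.of_contDiff (by fun_prop)
  have hE' : ∀ s, HasDerivAt (fun s => exp (-k * s)) (exp (-k * s) * (-k)) s := fun s =>
    (by simpa using ((hasDerivAt_id s).const_mul (-k)) :
      HasDerivAt (fun s => -k * s) (-k) s).exp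
  have hE1 : ∀ s ∈ Icc 0 T, exp (-k * s) ≤ 1 := fun s hs =>
    exp_le_one_iff.2 (by nlinarith [hs.1])
  have key : ∀ s ∈ Icc 0 T, ∀ r, r ≤ B → exp (-k * s) * r ≤ B := by
    intro s hs r hr
    nlinarith [hE1 s hs, exp_pos (-k * s)]
  have h := integral_le_of_divergence_le hL hT hB hΩ hsub (hE.mul hΦ) (hE.mul hF) (hE.mul hG)
    (fun x hx y hy s hs => by
      have hm : (x, y, s) ∈ Ω := hsub (QT_subset_closedBox ⟨hx, hy, hs⟩)
      have d1 : Dt (fun x y s => exp (-k * s) * Φ x y s) x y s = _ :=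
        ((hE' s).mul (hΦ.hasDerivAt_t hΩ hm)).deriv
      have d2 : Dx (fun x y s => exp (-k * s) * F x y s) x y s = _ :=
        ((hF.hasDerivAt_x hΩ hm).const_mul _).deriv
      have d3 : Dy (fun x y s => exp (-k * s) * G x y s) x y s = _ :=
        ((hG.hasDerivAt_y hΩ hm).const_mul _).deriv
      rw [d1, d2, d3]
      have := key s ⟨hs.1.le, hs.2.le⟩ _ (sub_le_iff_le_add'.2 (hdiv x hx y hy s hs))
      linarith)
    (fun y hy s hs => by rw [← mul_sub]; exact key s hs _ (hFx y hy s hs))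
    (fun x hx s hs => by rw [← mul_sub]; exact key s hs _ (hGy x hx s hs))
    (fun x hx y hy => by simpa using hinit x hx y hy) t ht
  simp only [intervalIntegral.integral_const_mul] at h
  have hpos : 0 ≤ B * (1 + T) * L + B * T * L + B * T := by positivity
  have h2 : exp (k * t) * exp (-k * t) = 1 := by rw [← exp_add]; simp
  calc ∫ x in 0..L, ∫ y in 0..1, Φ x y t
      = exp (k * t) * (exp (-k * t) * ∫ x in 0..L, ∫ y in 0..1, Φ x y t) := by
        rw [← mul_assoc, h2, one_mul]
    _ ≤ exp (k * t) * (B * (1 + T) * L + B * T * L + B * T) := by gcongr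
    _ ≤ _ := by
        gcongr
        exact ht.2

/-- Smooth convex approximation `√(z² + δ²)` of `|z|`. -/
def smoothAbs (δ z : ℝ) : ℝ := √(z ^ 2 + δ ^ 2)

section smoothAbs

variable {δ : ℝ}

lemma smoothAbs_sq (δ z : ℝ) : smoothAbs δ z ^ 2 = z ^ 2 + δ ^ 2 := sq_sqrt (by positivity)

lemma smoothAbs_pos (hδ : 0 < δ) (z : ℝ) : 0 < smoothAbs δ z := sqrt_pos.2 (by positivity)

lemma abs_le_smoothAbs (δ z : ℝ) : |z| ≤ smoothAbs δ z := abs_le_sqrt (by nlinarith [sq_nonneg δ])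

lemma le_smoothAbs (δ z : ℝ) : δ ≤ smoothAbs δ z :=
  le_sqrt_of_sq_le (by nlinarith [sq_nonneg z])

lemma smoothAbs_le (hδ : 0 < δ) (z : ℝ) : smoothAbs δ z ≤ |z| + δ := by
  rw [smoothAbs, sqrt_le_left (by positivity)]
  nlinarith [sq_abs z, abs_nonneg z]

lemma abs_div_smoothAbs_le (hδ : 0 < δ) (z : ℝ) : |z / smoothAbs δ z| ≤ 1 := by
  rw [abs_div, abs_of_pos (smoothAbs_pos hδ z), div_le_one (smoothAbs_pos hδ z)]
  exact abs_le_smoothAbs δ z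

lemma smoothAbs_sub_nonneg (hδ : 0 < δ) (z : ℝ) : 0 ≤ smoothAbs δ z - z / smoothAbs δ z * z := by
  have := smoothAbs_pos hδ z
  rw [sub_nonneg, div_mul_eq_mul_div, div_le_iff₀ this]
  nlinarith [smoothAbs_sq δ z, sq_nonneg δ]

lemma smoothAbs_sub_le (hδ : 0 < δ) (z : ℝ) : smoothAbs δ z - z / smoothAbs δ z * z ≤ δ := by
  have := smoothAbs_pos hδ z
  rw [sub_le_iff_le_add, div_mul_eq_mul_div, ← sub_le_iff_le_add', le_div_iff₀ this]
  nlinarith [smoothAbs_sq δ z, le_smoothAbs δ z]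

lemma hasDerivAt_smoothAbs (hδ : 0 < δ) {f : ℝ → ℝ} {f' s : ℝ} (hf : HasDerivAt f f' s) :
    HasDerivAt (fun r => smoothAbs δ (f r)) (f s * f' / smoothAbs δ (f s)) s := by
  have h := ((hf.fun_pow 2).add_const (δ ^ 2)).sqrt
    (add_pos_of_nonneg_of_pos (sq_nonneg _) (pow_pos hδ 2)).ne'
  refine h.congr_deriv ?_
  have := smoothAbs_pos hδ (f s)
  simp only [smoothAbs] at this ⊢
  simp
  field_simp

lemma SmoothOn.smoothAbs {Ω : Set (ℝ × ℝ × ℝ)} (hδ : 0 < δ) {z : ℝ → ℝ → ℝ → ℝ}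
    (hz : SmoothOn Ω z) : SmoothOn Ω (fun x y t => smoothAbs δ (z x y t)) :=
  ((hz.pow 2).add (SmoothOn.const (δ ^ 2))).sqrt fun _ _ =>
    (add_pos_of_nonneg_of_pos (sq_nonneg _) (pow_pos hδ 2)).ne'

end smoothAbs

/-- The weighted renormalized density `(1-y+ε)² |z| / w²` (with `|·|` smoothed). -/
def density (ε δ : ℝ) (w z : ℝ → ℝ → ℝ → ℝ) (x y t : ℝ) : ℝ :=
  (1 - y + ε) ^ 2 * smoothAbs δ (z x y t) / w x y t ^ 2

/-- The normal flux associated with `density`. -/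
def normalFlux (ε δ : ℝ) (w b z : ℝ → ℝ → ℝ → ℝ) (x y t : ℝ) : ℝ :=
  b x y t * density ε δ w z x y t
    - (1 - y + ε) ^ 2 * (z x y t * Dy z x y t / smoothAbs δ (z x y t))
    - 2 * (1 - y + ε) * smoothAbs δ (z x y t)

section density

variable {Ω : Set (ℝ × ℝ × ℝ)} {ε δ : ℝ} {w A b z : ℝ → ℝ → ℝ → ℝ}

lemma SmoothOn.weight (Ω : Set (ℝ × ℝ × ℝ)) (ε : ℝ) :
    SmoothOn Ω (fun _ y _ => 1 - y + ε) := SmoothOn.of_contDiff (by fun_prop)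

lemma SmoothOn.density (hδ : 0 < δ) (hw : SmoothOn Ω w) (hz : SmoothOn Ω z)
    (hpos : ∀ q ∈ Ω, 0 < w q.1 q.2.1 q.2.2) : SmoothOn Ω (density ε δ w z) :=
  (((SmoothOn.weight Ω ε).pow 2).mul (hz.smoothAbs hδ)).div (hw.pow 2)
    fun q hq => pow_ne_zero 2 (hpos q hq).ne'

lemma SmoothOn.normalFlux (hΩ : IsOpen Ω) (hδ : 0 < δ) (hw : SmoothOn Ω w) (hb : SmoothOn Ω b)
    (hz : SmoothOn Ω z) (hpos : ∀ q ∈ Ω, 0 < w q.1 q.2.1 q.2.2) :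
    SmoothOn Ω (normalFlux ε δ w b z) :=
  ((hb.mul (SmoothOn.density hδ hw hz hpos)).sub
    (((SmoothOn.weight Ω ε).pow 2).mul
      ((hz.mul (hz.dy hΩ)).div (hz.smoothAbs hδ) fun _ _ => (smoothAbs_pos hδ _).ne'))).sub
    (((SmoothOn.const 2).mul (SmoothOn.weight Ω ε)).mul (hz.smoothAbs hδ))

lemma divergence_density (hΩ : IsOpen Ω) (hδ : 0 < δ) (hw : SmoothOn Ω w) (hA : SmoothOn Ω A)
    (hb : SmoothOn Ω b) (hz : SmoothOn Ω z) (hpos : ∀ q ∈ Ω, 0 < w q.1 q.2.1 q.2.2)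
    {x y t : ℝ} (h : (x, y, t) ∈ Ω) :
    Dt (density ε δ w z) x y t + Dx (fun x y t => A x y t * density ε δ w z x y t) x y t
      + Dy (normalFlux ε δ w b z) x y t
    = Dx A x y t * density ε δ w z x y t + Dy b x y t * density ε δ w z x y t
      + 2 * smoothAbs δ (z x y t)
      - 2 * (1 - y + ε) * b x y t * smoothAbs δ (z x y t) / w x y t ^ 2
      - (1 - y + ε) ^ 2 * (Dy z x y t ^ 2 / smoothAbs δ (z x y t)
          - z x y t ^ 2 * Dy z x y t ^ 2 / smoothAbs δ (z x y t) ^ 3)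
      + (1 - y + ε) ^ 2 * (z x y t / smoothAbs δ (z x y t)
          * (Dt z x y t + A x y t * Dx z x y t + b x y t * Dy z x y t
              - w x y t ^ 2 * Dy (Dy z) x y t) / w x y t ^ 2
          - 2 * smoothAbs δ (z x y t)
            * (Dt w x y t + A x y t * Dx w x y t + b x y t * Dy w x y t) / w x y t ^ 3) := by
  have hw0 : w x y t ≠ 0 := (hpos _ h).ne'
  have hj0 : smoothAbs δ (z x y t) ≠ 0 := (smoothAbs_pos hδ _).ne'
  have hd : HasDerivAt (fun s => 1 - s + ε) (-1) y := by
    simpa using ((hasDerivAt_id y).const_sub 1).add_const ε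
  have dt : Dt (density ε δ w z) x y t = _ :=
    (((hasDerivAt_smoothAbs hδ (hz.hasDerivAt_t hΩ h)).const_mul ((1 - y + ε) ^ 2)).fun_div
      ((hw.hasDerivAt_t hΩ h).fun_pow 2) (pow_ne_zero 2 hw0)).deriv
  have dx : Dx (fun x y t => A x y t * density ε δ w z x y t) x y t = _ :=
    ((hA.hasDerivAt_x hΩ h).fun_mul
      (((hasDerivAt_smoothAbs hδ (hz.hasDerivAt_x hΩ h)).const_mul ((1 - y + ε) ^ 2)).fun_div
      ((hw.hasDerivAt_x hΩ h).fun_pow 2) (pow_ne_zero 2 hw0))).deriv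
  have hj := hasDerivAt_smoothAbs hδ (hz.hasDerivAt_y hΩ h)
  have dy : Dy (normalFlux ε δ w b z) x y t = _ :=
    ((((hb.hasDerivAt_y hΩ h).fun_mul
      (((hd.fun_pow 2).fun_mul hj).fun_div
        ((hw.hasDerivAt_y hΩ h).fun_pow 2) (pow_ne_zero 2 hw0))).fun_sub
      ((hd.fun_pow 2).fun_mul (((hz.hasDerivAt_y hΩ h).fun_mul
        ((hz.dy hΩ).hasDerivAt_y hΩ h)).fun_div hj hj0))).fun_sub
      ((hd.const_mul 2).fun_mul hj)).deriv
  rw [dt, dx, dy]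
  simp only [density]
  field_simp
  ring

end density

/-- The transport-diffusion terms of the density are controlled pointwise. -/
lemma density_source_le {m δ z j j' d w u o Ax by' b c D Q Aδ bδ cδ h wy zy lin : ℝ}
    (hm : 1 ≤ m) (hj : 0 < j) (hk1 : |z / j| ≤ 1) (hk2 : 0 ≤ j - z / j * z)
    (hk3 : j - z / j * z ≤ δ) (hjh : |h| ≤ j') (hd : 0 < d) (hw : 0 < w)
    (hdw : d ≤ m * w) (hwd : w ≤ m * d) (ho : 0 ≤ o) (how : o ≤ m * w) (hod : o ≤ d)
    (hw2 : w ≤ 2 * m) (hu : 0 ≤ u) (huw : u ≤ w)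
    (hAx : |Ax| ≤ m) (hby : |by'| ≤ 3 * m) (hb : |b| ≤ 2 * m * o) (hc : |c| ≤ 2 * m)
    (hAδ : |Aδ| ≤ m) (hbδ : |bδ| ≤ 2 * m * o) (hcδ : |cδ| ≤ 2 * m)
    (hQ : Q = Aδ * h + bδ * wy + cδ * u)
    (hlin : lin = 2 * z * (D + c * u) / w - Q - c * z)
    (hδ : |2 * d ^ 2 * D / w ^ 3| * δ ≤ 1) :
    Ax * (d ^ 2 * j / w ^ 2) + by' * (d ^ 2 * j / w ^ 2) + 2 * j - 2 * d * b * j / w ^ 2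
      - d ^ 2 * (zy ^ 2 / j - z ^ 2 * zy ^ 2 / j ^ 3)
      + d ^ 2 * (z / j * lin / w ^ 2 - 2 * j * D / w ^ 3)
    ≤ (14 * m + 2 * m ^ 2) * (d ^ 2 * j / w ^ 2) + m * (d ^ 2 * j' / w ^ 2)
      + m ^ 4 * (w * wy ^ 2) + (2 * m ^ 5 + 4 * m ^ 4 + 1) := by
  set k := z / j with hk
  have hzk : z = k * j := by rw [hk]; field_simp
  set R := d ^ 2 / w ^ 2 with hR
  have hR0 : 0 < R := by positivity
  have hRm : R ≤ m ^ 2 := by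
    rw [hR, div_le_iff₀ (by positivity), ← mul_pow]; gcongr
  have hRm' : 1 ≤ m ^ 2 * R := by
    rw [hR, ← mul_div_assoc, le_div_iff₀ (by positivity), ← mul_pow, one_mul]; gcongr
  have hm0 : 0 < m := one_pos.trans_le hm
  have e1 : d ^ 2 * j / w ^ 2 = R * j := by rw [hR]; ring
  have e1' : d ^ 2 * j' / w ^ 2 = R * j' := by rw [hR]; ring
  rw [e1, e1']
  have hJ : 0 < R * j := by positivity
  have b1 : Ax * (R * j) ≤ m * (R * j) := by gcongr; exact (abs_le.1 hAx).2
  have b2 : by' * (R * j) ≤ 3 * m * (R * j) := by gcongr; exact (abs_le.1 hby).2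
  have b3 : 2 * j ≤ 2 * m ^ 2 * (R * j) := by
    have := mul_le_mul_of_nonneg_right hRm' hj.le
    linarith only [this]
  have b4 : -(2 * d * b * j / w ^ 2) ≤ 4 * m * (R * j) := by
    have : -b ≤ 2 * m * d := by
      have h1 := (abs_le.1 hb).1
      have h2 : 2 * m * o ≤ 2 * m * d := by gcongr
      linarith only [h1, h2]
    calc -(2 * d * b * j / w ^ 2) = 2 * d * j / w ^ 2 * (-b) := by ring
      _ ≤ 2 * d * j / w ^ 2 * (2 * m * d) := by gcongr
      _ = 4 * m * (R * j) := by rw [hR]; ring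
  have b5 : 0 ≤ d ^ 2 * (zy ^ 2 / j - z ^ 2 * zy ^ 2 / j ^ 3) := by
    have : zy ^ 2 / j - z ^ 2 * zy ^ 2 / j ^ 3 = zy ^ 2 / j ^ 2 * (j - k * z) := by
      rw [hk]; field_simp
    rw [this]; positivity
  have e2 : d ^ 2 * (k * lin / w ^ 2 - 2 * j * D / w ^ 3)
      = -((2 * d ^ 2 * D / w ^ 3) * (j - k * z)) + R * (2 * (k * z) * c * (u / w))
        - R * (k * Q) - R * (c * (k * z)) := by
    rw [hlin, hR]; field_simp; ring
  have hkz : |k * z| ≤ j := by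
    rw [hzk, ← mul_assoc, abs_mul, abs_mul, abs_of_pos hj]
    exact mul_le_of_le_one_left hj.le (mul_le_one₀ hk1 (abs_nonneg k) hk1)
  have b6 : -((2 * d ^ 2 * D / w ^ 3) * (j - k * z)) ≤ 1 := by
    refine le_trans ?_ hδ
    refine (neg_le_abs _).trans ?_
    rw [abs_mul, abs_of_nonneg hk2]
    gcongr
  have b7 : R * (2 * (k * z) * c * (u / w)) ≤ 4 * m * (R * j) := by
    have : 2 * (k * z) * c * (u / w) ≤ 2 * j * (2 * m) * 1 := by
      refine (le_abs_self _).trans ?_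
      rw [abs_mul, abs_mul, abs_mul, abs_two, abs_of_nonneg (div_nonneg hu hw.le)]
      gcongr
      exact (div_le_one hw).2 huw
    have := mul_le_mul_of_nonneg_left this hR0.le
    linarith only [this]
  have b8 : -(R * (c * (k * z))) ≤ 2 * m * (R * j) := by
    have : -(c * (k * z)) ≤ 2 * m * j := by
      refine (neg_le_abs _).trans ?_
      rw [abs_mul]
      gcongr
    have := mul_le_mul_of_nonneg_left this hR0.le
    linarith only [this]
  have b9 : -(k * Q) ≤ m * j' + 2 * m * o * |wy| + 2 * m * u := by
    refine (neg_le_abs _).trans ?_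
    rw [abs_mul]
    have h1 : |Q| ≤ m * j' + 2 * m * o * |wy| + 2 * m * u := by
      rw [hQ]
      refine (abs_add_three _ _ _).trans ?_
      rw [abs_mul, abs_mul, abs_mul, abs_of_nonneg hu]
      gcongr
    exact (mul_le_of_le_one_left (abs_nonneg Q) hk1).trans h1
  have b10 : R * (2 * m * o * |wy|) ≤ m ^ 4 * (w * wy ^ 2) + 2 * m ^ 5 := by
    have h1 : R * (2 * m * o * |wy|) ≤ m ^ 2 * (2 * m * (m * w) * |wy|) := by gcongr
    have h2 : 2 * |wy| ≤ 1 + wy ^ 2 := by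
      have := sq_nonneg (|wy| - 1)
      rw [sub_sq, sq_abs] at this
      linarith only [this]
    have h3 : m ^ 4 * w * (2 * |wy|) ≤ m ^ 4 * w * (1 + wy ^ 2) := by gcongr
    have h4 : m ^ 4 * w ≤ m ^ 4 * (2 * m) := by gcongr
    linarith only [h1, h3, h4]
  have b11 : R * (2 * m * u) ≤ 4 * m ^ 4 := by
    calc R * (2 * m * u) ≤ m ^ 2 * (2 * m * (2 * m)) := by gcongr; exact huw.trans hw2
      _ = 4 * m ^ 4 := by ring
  have b12 : -(R * (k * Q)) ≤ R * (m * j' + 2 * m * o * |wy| + 2 * m * u) := by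
    rw [← mul_neg]; gcongr
  rw [e2]
  linarith only [b1, b2, b3, b4, b5, b6, b7, b8, b10, b11, b12]

namespace SmoothOn

variable {Ω : Set (ℝ × ℝ × ℝ)} {f : ℝ → ℝ → ℝ → ℝ}

lemma eventually_mem_y (hΩ : IsOpen Ω) {x y t : ℝ} (h : (x, y, t) ∈ Ω) :
    ∀ᶠ s in 𝓝 y, (x, s, t) ∈ Ω :=
  (show Continuous (fun s : ℝ => (x, s, t)) by fun_prop).continuousAt.eventually
    (hΩ.mem_nhds h)

lemma dy_dy_dx_comm (hf : SmoothOn Ω f) (hΩ : IsOpen Ω) {x y t : ℝ} (h : (x, y, t) ∈ Ω) :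
    Dy (Dy (Dx f)) x y t = Dx (Dy (Dy f)) x y t := by
  rw [← (hf.dy hΩ).dy_dx_comm hΩ h]
  refine Filter.EventuallyEq.deriv_eq ?_
  filter_upwards [eventually_mem_y hΩ h] with s hs using hf.dy_dx_comm hΩ hs

lemma dy_dy_dt_comm (hf : SmoothOn Ω f) (hΩ : IsOpen Ω) {x y t : ℝ} (h : (x, y, t) ∈ Ω) :
    Dy (Dy (Dt f)) x y t = Dt (Dy (Dy f)) x y t := by
  rw [← (hf.dy hΩ).dy_dt_comm hΩ h]
  refine Filter.EventuallyEq.deriv_eq ?_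
  filter_upwards [eventually_mem_y hΩ h] with s hs using hf.dy_dt_comm hΩ hs

end SmoothOn

/-- A positive solution `w = u + ε` of the shifted equation
`∂ₜw + A∂ₓw + b∂_yw + c(w-ε) = w²∂_y²w`, with all structural bounds expressed by one
constant `m`. -/
structure ShiftedSolution (L T ε m : ℝ) (Ω : Set (ℝ × ℝ × ℝ)) (w A b c : ℝ → ℝ → ℝ → ℝ) :
    Prop where
  isOpen : IsOpen Ω
  subset : closedBox L T ⊆ Ω
  smooth_w : SmoothOn Ω w
  smooth_A : SmoothOn Ω A
  smooth_b : SmoothOn Ω b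
  smooth_c : SmoothOn Ω c
  pos : ∀ q ∈ Ω, 0 < w q.1 q.2.1 q.2.2
  pde : ∀ x ∈ Ioo 0 L, ∀ y ∈ Ioo (0:ℝ) 1, ∀ t ∈ Ioo 0 T,
    Dt w x y t + A x y t * Dx w x y t + b x y t * Dy w x y t
      - w x y t ^ 2 * Dy (Dy w) x y t + c x y t * (w x y t - ε) = 0
  lower : ∀ x ∈ Icc 0 L, ∀ y ∈ Icc (0:ℝ) 1, ∀ t ∈ Icc 0 T, 1 - y ≤ m * (w x y t - ε)
  upper : ∀ x ∈ Icc 0 L, ∀ y ∈ Icc (0:ℝ) 1, ∀ t ∈ Icc 0 T, w x y t - ε ≤ m * (1 - y)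
  A_nonneg : ∀ x ∈ Icc 0 L, ∀ y ∈ Icc (0:ℝ) 1, ∀ t ∈ Icc 0 T, 0 ≤ A x y t
  A_le : ∀ x ∈ Icc 0 L, ∀ y ∈ Icc (0:ℝ) 1, ∀ t ∈ Icc 0 T, A x y t ≤ 2 * m
  dx_A : ∀ x ∈ Icc 0 L, ∀ y ∈ Icc (0:ℝ) 1, ∀ t ∈ Icc 0 T, |Dx A x y t| ≤ m
  dt_A : ∀ x ∈ Icc 0 L, ∀ y ∈ Icc (0:ℝ) 1, ∀ t ∈ Icc 0 T, |Dt A x y t| ≤ m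
  abs_b : ∀ x ∈ Icc 0 L, ∀ y ∈ Icc (0:ℝ) 1, ∀ t ∈ Icc 0 T, |b x y t| ≤ 2 * m * (1 - y)
  dx_b : ∀ x ∈ Icc 0 L, ∀ y ∈ Icc (0:ℝ) 1, ∀ t ∈ Icc 0 T, |Dx b x y t| ≤ 2 * m * (1 - y)
  dy_b : ∀ x ∈ Icc 0 L, ∀ y ∈ Icc (0:ℝ) 1, ∀ t ∈ Icc 0 T, |Dy b x y t| ≤ 3 * m
  dt_b : ∀ x ∈ Icc 0 L, ∀ y ∈ Icc (0:ℝ) 1, ∀ t ∈ Icc 0 T, |Dt b x y t| ≤ 2 * m * (1 - y)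
  abs_c : ∀ x ∈ Icc 0 L, ∀ y ∈ Icc (0:ℝ) 1, ∀ t ∈ Icc 0 T, |c x y t| ≤ 2 * m
  dx_c : ∀ x ∈ Icc 0 L, ∀ y ∈ Icc (0:ℝ) 1, ∀ t ∈ Icc 0 T, |Dx c x y t| ≤ 2 * m
  dt_c : ∀ x ∈ Icc 0 L, ∀ y ∈ Icc (0:ℝ) 1, ∀ t ∈ Icc 0 T, |Dt c x y t| ≤ 2 * m
  b_bottom : ∀ x ∈ Icc 0 L, ∀ t ∈ Icc 0 T, 0 ≤ b x 0 t
  dy_bottom : ∀ x ∈ Icc 0 L, ∀ t ∈ Icc 0 T, |Dy w x 0 t| ≤ 2 * m ^ 2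
  dy_dx_bottom : ∀ x ∈ Icc 0 L, ∀ t ∈ Icc 0 T,
    |Dy (Dx w) x 0 t - Dx w x 0 t * b x 0 t / w x 0 t ^ 2| ≤ 2 * m ^ 2
  dy_dt_bottom : ∀ x ∈ Icc 0 L, ∀ t ∈ Icc 0 T,
    |Dy (Dt w) x 0 t - Dt w x 0 t * b x 0 t / w x 0 t ^ 2| ≤ 2 * m ^ 2
  dx_top : ∀ x ∈ Icc 0 L, ∀ t ∈ Icc 0 T, Dx w x 1 t = 0
  dt_top : ∀ x ∈ Icc 0 L, ∀ t ∈ Icc 0 T, Dt w x 1 t = 0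
  dy_top : ∀ x ∈ Icc 0 L, ∀ t ∈ Icc 0 T, Dy w x 1 t ≤ 0
  dt_inflow : ∀ y ∈ Icc (0:ℝ) 1, ∀ t ∈ Icc 0 T, |Dt w 0 y t| ≤ m
  dx_inflow : ∀ y ∈ Icc (0:ℝ) 1, ∀ t ∈ Icc 0 T, |A 0 y t * Dx w 0 y t| ≤ 12 * m ^ 3
  dx_initial : ∀ x ∈ Icc 0 L, ∀ y ∈ Icc (0:ℝ) 1, |Dx w x y 0| ≤ m
  dt_initial : ∀ x ∈ Icc 0 L, ∀ y ∈ Icc (0:ℝ) 1, |Dt w x y 0| ≤ 12 * m ^ 3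

namespace ShiftedSolution

variable {L T ε m : ℝ} {Ω : Set (ℝ × ℝ × ℝ)} {w A b c : ℝ → ℝ → ℝ → ℝ}

lemma pde_dx (S : ShiftedSolution L T ε m Ω w A b c) {x y t : ℝ} (hx : x ∈ Ioo 0 L)
    (hy : y ∈ Ioo (0:ℝ) 1) (ht : t ∈ Ioo 0 T) :
    Dt (Dx w) x y t + A x y t * Dx (Dx w) x y t + b x y t * Dy (Dx w) x y t
      - w x y t ^ 2 * Dy (Dy (Dx w)) x y t
    = 2 * Dx w x y t * ((Dt w x y t + A x y t * Dx w x y t + b x y t * Dy w x y t)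
        + c x y t * (w x y t - ε)) / w x y t
      - (Dx A x y t * Dx w x y t + Dx b x y t * Dy w x y t + Dx c x y t * (w x y t - ε))
      - c x y t * Dx w x y t := by
  have h : (x, y, t) ∈ Ω := S.subset (QT_subset_closedBox ⟨hx, hy, ht⟩)
  have hΩ := S.isOpen
  have hw := S.smooth_w
  have hw0 : w x y t ≠ 0 := (S.pos _ h).ne'
  have h1 := (((((hw.dt hΩ).hasDerivAt_x hΩ h).fun_add
    ((S.smooth_A.hasDerivAt_x hΩ h).fun_mul ((hw.dx hΩ).hasDerivAt_x hΩ h))).fun_add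
    ((S.smooth_b.hasDerivAt_x hΩ h).fun_mul ((hw.dy hΩ).hasDerivAt_x hΩ h))).fun_sub
    (((hw.hasDerivAt_x hΩ h).fun_pow 2).fun_mul
      (((hw.dy hΩ).dy hΩ).hasDerivAt_x hΩ h))).fun_add
    ((S.smooth_c.hasDerivAt_x hΩ h).fun_mul ((hw.hasDerivAt_x hΩ h).sub_const ε))
  have h2 := h1.unique ((hasDerivAt_const x (0:ℝ)).congr_of_eventuallyEq (by
    filter_upwards [Ioo_mem_nhds hx.1 hx.2] with s hs using S.pde s hs y hy t ht))
  have h3 := S.pde x hx y hy t ht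
  rw [hw.dt_dx_comm hΩ h, hw.dy_dx_comm hΩ h, hw.dy_dy_dx_comm hΩ h,
    show Dt w x y t + A x y t * Dx w x y t + b x y t * Dy w x y t + c x y t * (w x y t - ε)
      = w x y t ^ 2 * Dy (Dy w) x y t by linarith only [h3],
    show 2 * Dx w x y t * (w x y t ^ 2 * Dy (Dy w) x y t) / w x y t
      = 2 * Dx w x y t * w x y t * Dy (Dy w) x y t by field_simp]
  norm_num at h2
  linarith only [h2]

lemma pde_dt (S : ShiftedSolution L T ε m Ω w A b c) {x y t : ℝ} (hx : x ∈ Ioo 0 L)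
    (hy : y ∈ Ioo (0:ℝ) 1) (ht : t ∈ Ioo 0 T) :
    Dt (Dt w) x y t + A x y t * Dx (Dt w) x y t + b x y t * Dy (Dt w) x y t
      - w x y t ^ 2 * Dy (Dy (Dt w)) x y t
    = 2 * Dt w x y t * ((Dt w x y t + A x y t * Dx w x y t + b x y t * Dy w x y t)
        + c x y t * (w x y t - ε)) / w x y t
      - (Dt A x y t * Dx w x y t + Dt b x y t * Dy w x y t + Dt c x y t * (w x y t - ε))
      - c x y t * Dt w x y t := by
  have h : (x, y, t) ∈ Ω := S.subset (QT_subset_closedBox ⟨hx, hy, ht⟩)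
  have hΩ := S.isOpen
  have hw := S.smooth_w
  have hw0 : w x y t ≠ 0 := (S.pos _ h).ne'
  have h1 := (((((hw.dt hΩ).hasDerivAt_t hΩ h).fun_add
    ((S.smooth_A.hasDerivAt_t hΩ h).fun_mul ((hw.dx hΩ).hasDerivAt_t hΩ h))).fun_add
    ((S.smooth_b.hasDerivAt_t hΩ h).fun_mul ((hw.dy hΩ).hasDerivAt_t hΩ h))).fun_sub
    (((hw.hasDerivAt_t hΩ h).fun_pow 2).fun_mul
      (((hw.dy hΩ).dy hΩ).hasDerivAt_t hΩ h))).fun_add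
    ((S.smooth_c.hasDerivAt_t hΩ h).fun_mul ((hw.hasDerivAt_t hΩ h).sub_const ε))
  have h2 := h1.unique ((hasDerivAt_const t (0:ℝ)).congr_of_eventuallyEq (by
    filter_upwards [Ioo_mem_nhds ht.1 ht.2] with s hs using S.pde x hx y hy s hs))
  have h3 := S.pde x hx y hy t ht
  rw [← hw.dt_dx_comm hΩ h, hw.dy_dt_comm hΩ h, hw.dy_dy_dt_comm hΩ h,
    show Dt w x y t + A x y t * Dx w x y t + b x y t * Dy w x y t + c x y t * (w x y t - ε)
      = w x y t ^ 2 * Dy (Dy w) x y t by linarith only [h3],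
    show 2 * Dt w x y t * (w x y t ^ 2 * Dy (Dy w) x y t) / w x y t
      = 2 * Dt w x y t * w x y t * Dy (Dy w) x y t by field_simp]
  norm_num at h2
  linarith only [h2]

lemma one_sub_add_le_mul (S : ShiftedSolution L T ε m Ω w A b c) (hm : 1 ≤ m) (hε : 0 < ε)
    {x y t : ℝ} (hx : x ∈ Icc 0 L) (hy : y ∈ Icc (0:ℝ) 1) (ht : t ∈ Icc 0 T) :
    1 - y + ε ≤ m * w x y t := by
  have := S.lower x hx y hy t ht
  nlinarith only [this, hm, hε]

lemma le_mul_one_sub_add (S : ShiftedSolution L T ε m Ω w A b c) (hm : 1 ≤ m) (hε : 0 < ε)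
    {x y t : ℝ} (hx : x ∈ Icc 0 L) (hy : y ∈ Icc (0:ℝ) 1) (ht : t ∈ Icc 0 T) :
    w x y t ≤ m * (1 - y + ε) := by
  have := S.upper x hx y hy t ht
  nlinarith only [this, hm, hε]

lemma w_le (S : ShiftedSolution L T ε m Ω w A b c) (hm : 1 ≤ m) (hε1 : ε < 1)
    {x y t : ℝ} (hx : x ∈ Icc 0 L) (hy : y ∈ Icc (0:ℝ) 1) (ht : t ∈ Icc 0 T) :
    w x y t ≤ 2 * m := by
  have := S.upper x hx y hy t ht
  nlinarith only [this, hm, hε1, hy.1]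

lemma sub_nonneg (S : ShiftedSolution L T ε m Ω w A b c) (hm : 1 ≤ m)
    {x y t : ℝ} (hx : x ∈ Icc 0 L) (hy : y ∈ Icc (0:ℝ) 1) (ht : t ∈ Icc 0 T) :
    0 ≤ w x y t - ε := by
  have := S.lower x hx y hy t ht
  by_contra hneg
  nlinarith only [this, hm, hneg, hy.2]

lemma weight_div_le (S : ShiftedSolution L T ε m Ω w A b c) (hm : 1 ≤ m) (hε : 0 < ε)
    {x y t : ℝ} (hx : x ∈ Icc 0 L) (hy : y ∈ Icc (0:ℝ) 1) (ht : t ∈ Icc 0 T) :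
    (1 - y + ε) ^ 2 / w x y t ^ 2 ≤ m ^ 2 := by
  have hw := S.pos _ (S.subset (show (x, y, t) ∈ closedBox L T from ⟨hx, hy, ht⟩))
  have hd : 0 < 1 - y + ε := by linarith only [hy.2, hε]
  rw [div_le_iff₀ (pow_pos hw 2), ← mul_pow]
  exact pow_le_pow_left₀ hd.le (S.one_sub_add_le_mul hm hε hx hy ht) 2

lemma one_le_weight_div (S : ShiftedSolution L T ε m Ω w A b c) (hm : 1 ≤ m) (hε : 0 < ε)
    {x y t : ℝ} (hx : x ∈ Icc 0 L) (hy : y ∈ Icc (0:ℝ) 1) (ht : t ∈ Icc 0 T) :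
    1 ≤ m ^ 2 * ((1 - y + ε) ^ 2 / w x y t ^ 2) := by
  have hw := S.pos _ (S.subset (show (x, y, t) ∈ closedBox L T from ⟨hx, hy, ht⟩))
  rw [← mul_div_assoc, le_div_iff₀ (pow_pos hw 2), ← mul_pow, one_mul]
  exact pow_le_pow_left₀ hw.le (S.le_mul_one_sub_add hm hε hx hy ht) 2

lemma density_eq (ε δ : ℝ) (w z : ℝ → ℝ → ℝ → ℝ) (x y t : ℝ) :
    density ε δ w z x y t = (1 - y + ε) ^ 2 / w x y t ^ 2 * smoothAbs δ (z x y t) := by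
  rw [density]; ring

lemma density_nonneg (ε δ : ℝ) (w z : ℝ → ℝ → ℝ → ℝ) (x y t : ℝ) :
    0 ≤ density ε δ w z x y t := by
  rw [density, smoothAbs]; positivity

lemma density_le (S : ShiftedSolution L T ε m Ω w A b c) (hm : 1 ≤ m) (hε : 0 < ε)
    {δ K : ℝ} (hδ : 0 < δ) (hδ1 : δ ≤ 1) {z : ℝ → ℝ → ℝ → ℝ}
    {x y t : ℝ} (hx : x ∈ Icc 0 L) (hy : y ∈ Icc (0:ℝ) 1) (ht : t ∈ Icc 0 T)
    (hz : |z x y t| ≤ K) :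
    density ε δ w z x y t ≤ m ^ 2 * (K + 1) := by
  rw [density_eq]
  have := smoothAbs_le hδ (z x y t)
  have h0 := (smoothAbs_pos hδ (z x y t)).le
  have := S.weight_div_le hm hε hx hy ht
  gcongr
  linarith

lemma abs_le_density (S : ShiftedSolution L T ε m Ω w A b c) (hm : 1 ≤ m) (hε : 0 < ε)
    (δ : ℝ) (z : ℝ → ℝ → ℝ → ℝ)
    {x y t : ℝ} (hx : x ∈ Icc 0 L) (hy : y ∈ Icc (0:ℝ) 1) (ht : t ∈ Icc 0 T) :
    |z x y t| ≤ m ^ 2 * density ε δ w z x y t := by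
  rw [density_eq, ← mul_assoc]
  refine (abs_le_smoothAbs δ _).trans ?_
  exact le_mul_of_one_le_left (sqrt_nonneg _) (S.one_le_weight_div hm hε hx hy ht)

end ShiftedSolution

lemma isCompact_closedBox (L T : ℝ) : IsCompact (closedBox L T) :=
  isCompact_Icc.prod (isCompact_Icc.prod isCompact_Icc)

namespace ShiftedSolution

variable {L T ε m δ : ℝ} {Ω : Set (ℝ × ℝ × ℝ)} {w A b c : ℝ → ℝ → ℝ → ℝ}

/-- The renormalized tangential density `Φ`. -/
def totalDensity (ε δ m : ℝ) (w : ℝ → ℝ → ℝ → ℝ) (x y t : ℝ) : ℝ :=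
  density ε δ w (Dx w) x y t + density ε δ w (Dt w) x y t + m ^ 4 * w x y t

/-- The flux of `totalDensity` in the `x` direction. -/
def totalFluxX (ε δ m : ℝ) (w A : ℝ → ℝ → ℝ → ℝ) (x y t : ℝ) : ℝ :=
  A x y t * density ε δ w (Dx w) x y t + A x y t * density ε δ w (Dt w) x y t
    + m ^ 4 * (A x y t * w x y t)

/-- The flux of `totalDensity` in the `y` direction. -/
def totalFluxY (ε δ m : ℝ) (w b : ℝ → ℝ → ℝ → ℝ) (x y t : ℝ) : ℝ :=
  normalFlux ε δ w b (Dx w) x y t + normalFlux ε δ w b (Dt w) x y t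
    + m ^ 4 * (b x y t * w x y t - w x y t ^ 2 * Dy w x y t)

lemma smooth_totalDensity (S : ShiftedSolution L T ε m Ω w A b c) (hδ : 0 < δ) :
    SmoothOn Ω (totalDensity ε δ m w) :=
  ((SmoothOn.density hδ S.smooth_w (S.smooth_w.dx S.isOpen) S.pos).add
    (SmoothOn.density hδ S.smooth_w (S.smooth_w.dt S.isOpen) S.pos)).add
    ((SmoothOn.const (m ^ 4)).mul S.smooth_w)

lemma smooth_totalFluxX (S : ShiftedSolution L T ε m Ω w A b c) (hδ : 0 < δ) :
    SmoothOn Ω (totalFluxX ε δ m w A) :=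
  ((S.smooth_A.mul (SmoothOn.density hδ S.smooth_w (S.smooth_w.dx S.isOpen) S.pos)).add
    (S.smooth_A.mul (SmoothOn.density hδ S.smooth_w (S.smooth_w.dt S.isOpen) S.pos))).add
    ((SmoothOn.const (m ^ 4)).mul (S.smooth_A.mul S.smooth_w))

lemma smooth_totalFluxY (S : ShiftedSolution L T ε m Ω w A b c) (hδ : 0 < δ) :
    SmoothOn Ω (totalFluxY ε δ m w b) :=
  ((SmoothOn.normalFlux S.isOpen hδ S.smooth_w S.smooth_b (S.smooth_w.dx S.isOpen) S.pos).add
    (SmoothOn.normalFlux S.isOpen hδ S.smooth_w S.smooth_b (S.smooth_w.dt S.isOpen) S.pos)).add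
    ((SmoothOn.const (m ^ 4)).mul ((S.smooth_b.mul S.smooth_w).sub
      ((S.smooth_w.pow 2).mul (S.smooth_w.dy S.isOpen))))

lemma exists_regularization (S : ShiftedSolution L T ε m Ω w A b c) :
    ∃ δ > (0:ℝ), δ ≤ 1 ∧ ∀ x ∈ Icc 0 L, ∀ y ∈ Icc (0:ℝ) 1, ∀ t ∈ Icc 0 T,
      |2 * (1 - y + ε) ^ 2 * (Dt w x y t + A x y t * Dx w x y t + b x y t * Dy w x y t)
        / w x y t ^ 3| * δ ≤ 1 := by
  have hΩ := S.isOpen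
  have hw := S.smooth_w
  have hs : SmoothOn Ω (fun x y t => 2 * (1 - y + ε) ^ 2 *
      (Dt w x y t + A x y t * Dx w x y t + b x y t * Dy w x y t) / w x y t ^ 3) :=
    (((SmoothOn.const 2).mul ((SmoothOn.weight Ω ε).pow 2)).mul
      (((hw.dt hΩ).add (S.smooth_A.mul (hw.dx hΩ))).add (S.smooth_b.mul (hw.dy hΩ)))).div
      (hw.pow 3) fun q hq => pow_ne_zero 3 (S.pos q hq).ne'
  obtain ⟨K, hK⟩ := (isCompact_closedBox L T).exists_bound_of_continuousOn
    (hs.continuousOn.mono S.subset)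
  have h1 : 1 ≤ max K 0 + 1 := by linarith only [le_max_right K 0]
  refine ⟨1 / (max K 0 + 1), by positivity, (div_le_one (by positivity)).2 h1, ?_⟩
  intro x hx y hy t ht
  have := hK (x, y, t) ⟨hx, hy, ht⟩
  rw [Real.norm_eq_abs] at this
  rw [mul_one_div, div_le_one (by positivity)]
  linarith only [this, le_max_left K 0]

lemma divergence_mul_le (S : ShiftedSolution L T ε m Ω w A b c) (hm : 1 ≤ m) (hε : 0 < ε)
    (hε1 : ε < 1) {x y t : ℝ} (hx : x ∈ Ioo 0 L) (hy : y ∈ Ioo (0:ℝ) 1) (ht : t ∈ Ioo 0 T) :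
    Dt w x y t + Dx (fun x y t => A x y t * w x y t) x y t
      + Dy (fun x y t => b x y t * w x y t - w x y t ^ 2 * Dy w x y t) x y t
    ≤ 12 * m ^ 2 - 2 * (w x y t * Dy w x y t ^ 2) := by
  have hb : (x, y, t) ∈ closedBox L T := QT_subset_closedBox ⟨hx, hy, ht⟩
  have h := S.subset hb
  obtain ⟨hx', hy', ht'⟩ := hb
  dsimp only at hx' hy' ht'
  have hΩ := S.isOpen
  have hw := S.smooth_w
  have dx : Dx (fun x y t => A x y t * w x y t) x y t = _ :=
    ((S.smooth_A.hasDerivAt_x hΩ h).fun_mul (hw.hasDerivAt_x hΩ h)).deriv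
  have dy : Dy (fun x y t => b x y t * w x y t - w x y t ^ 2 * Dy w x y t) x y t = _ :=
    (((S.smooth_b.hasDerivAt_y hΩ h).fun_mul (hw.hasDerivAt_y hΩ h)).fun_sub
      (((hw.hasDerivAt_y hΩ h).fun_pow 2).fun_mul ((hw.dy hΩ).hasDerivAt_y hΩ h))).deriv
  have h3 := S.pde x hx y hy t ht
  have hw0 := S.pos _ h
  have hw2 := S.w_le hm hε1 hx' hy' ht'
  have hu := S.sub_nonneg hm hx' hy' ht'
  have b1 : Dx A x y t * w x y t ≤ m * (2 * m) := by
    have := (abs_le.1 (S.dx_A x hx' y hy' t ht')).2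
    gcongr
  have b2 : Dy b x y t * w x y t ≤ 3 * m * (2 * m) := by
    have := (abs_le.1 (S.dy_b x hx' y hy' t ht')).2
    gcongr
  have b3 : -c x y t * (w x y t - ε) ≤ 2 * m * (2 * m) := by
    have := neg_le.1 (abs_le.1 (S.abs_c x hx' y hy' t ht')).1
    gcongr
    linarith only [hw2, hε]
  rw [dx, dy]
  norm_num
  linarith only [b1, b2, b3, h3]

lemma divergence_density_le (S : ShiftedSolution L T ε m Ω w A b c) (hm : 1 ≤ m) (hε : 0 < ε)
    (hε1 : ε < 1) (hδ : 0 < δ)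
    (hδD : ∀ x ∈ Icc 0 L, ∀ y ∈ Icc (0:ℝ) 1, ∀ t ∈ Icc 0 T,
      |2 * (1 - y + ε) ^ 2 * (Dt w x y t + A x y t * Dx w x y t + b x y t * Dy w x y t)
        / w x y t ^ 3| * δ ≤ 1)
    {x y t : ℝ} (hx : x ∈ Ioo 0 L) (hy : y ∈ Ioo (0:ℝ) 1) (ht : t ∈ Ioo 0 T)
    {z : ℝ → ℝ → ℝ → ℝ} (hz : SmoothOn Ω z) {Aδ bδ cδ : ℝ}
    (hAδ : |Aδ| ≤ m) (hbδ : |bδ| ≤ 2 * m * (1 - y)) (hcδ : |cδ| ≤ 2 * m)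
    (hlin : Dt z x y t + A x y t * Dx z x y t + b x y t * Dy z x y t
        - w x y t ^ 2 * Dy (Dy z) x y t
      = 2 * z x y t * ((Dt w x y t + A x y t * Dx w x y t + b x y t * Dy w x y t)
          + c x y t * (w x y t - ε)) / w x y t
        - (Aδ * Dx w x y t + bδ * Dy w x y t + cδ * (w x y t - ε)) - c x y t * z x y t) :
    Dt (density ε δ w z) x y t + Dx (fun x y t => A x y t * density ε δ w z x y t) x y t
      + Dy (normalFlux ε δ w b z) x y t
    ≤ (14 * m + 2 * m ^ 2) * density ε δ w z x y t + m * density ε δ w (Dx w) x y t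
      + m ^ 4 * (w x y t * Dy w x y t ^ 2) + (2 * m ^ 5 + 4 * m ^ 4 + 1) := by
  have hb : (x, y, t) ∈ closedBox L T := QT_subset_closedBox ⟨hx, hy, ht⟩
  have h := S.subset hb
  obtain ⟨hx', hy', ht'⟩ := hb
  dsimp only at hx' hy' ht'
  rw [divergence_density S.isOpen hδ S.smooth_w S.smooth_A S.smooth_b hz S.pos h]
  have hu := S.sub_nonneg hm hx' hy' ht'
  have hlow := S.lower x hx' y hy' t ht'
  have hmε : 0 < m * ε := by positivity
  exact density_source_le (o := 1 - y) (u := w x y t - ε) hm (smoothAbs_pos hδ _)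
    (abs_div_smoothAbs_le hδ _)
    (smoothAbs_sub_nonneg hδ _) (smoothAbs_sub_le hδ _) (abs_le_smoothAbs δ (Dx w x y t))
    (by linarith only [hy'.2, hε]) (S.pos _ h) (S.one_sub_add_le_mul hm hε hx' hy' ht')
    (S.le_mul_one_sub_add hm hε hx' hy' ht') (by linarith only [hy'.2])
    (by linarith only [hlow, hmε]) (by linarith only [hε]) (S.w_le hm hε1 hx' hy' ht')
    hu (by linarith only [hε]) (S.dx_A x hx' y hy' t ht') (S.dy_b x hx' y hy' t ht')
    (S.abs_b x hx' y hy' t ht') (S.abs_c x hx' y hy' t ht') hAδ hbδ hcδ rfl hlin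
    (hδD x hx' y hy' t ht')

lemma divergence_total_le (S : ShiftedSolution L T ε m Ω w A b c) (hm : 1 ≤ m) (hε : 0 < ε)
    (hε1 : ε < 1) (hδ : 0 < δ)
    (hδD : ∀ x ∈ Icc 0 L, ∀ y ∈ Icc (0:ℝ) 1, ∀ t ∈ Icc 0 T,
      |2 * (1 - y + ε) ^ 2 * (Dt w x y t + A x y t * Dx w x y t + b x y t * Dy w x y t)
        / w x y t ^ 3| * δ ≤ 1)
    {x y t : ℝ} (hx : x ∈ Ioo 0 L) (hy : y ∈ Ioo (0:ℝ) 1) (ht : t ∈ Ioo 0 T) :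
    Dt (totalDensity ε δ m w) x y t + Dx (totalFluxX ε δ m w A) x y t
      + Dy (totalFluxY ε δ m w b) x y t
    ≤ 18 * m ^ 2 * totalDensity ε δ m w x y t + 40 * m ^ 8 := by
  have hb : (x, y, t) ∈ closedBox L T := QT_subset_closedBox ⟨hx, hy, ht⟩
  have h := S.subset hb
  obtain ⟨hx', hy', ht'⟩ := hb
  dsimp only at hx' hy' ht'
  have hΩ := S.isOpen
  have hw := S.smooth_w
  have hwx := hw.dx hΩ
  have hwt := hw.dt hΩ
  have s1 := SmoothOn.density (ε := ε) hδ hw hwx S.pos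
  have s2 := SmoothOn.density (ε := ε) hδ hw hwt S.pos
  have n1 := SmoothOn.normalFlux (ε := ε) hΩ hδ hw S.smooth_b hwx S.pos
  have n2 := SmoothOn.normalFlux (ε := ε) hΩ hδ hw S.smooth_b hwt S.pos
  have et : Dt (totalDensity ε δ m w) x y t = _ :=
    (((s1.hasDerivAt_t hΩ h).fun_add (s2.hasDerivAt_t hΩ h)).fun_add
      ((hw.hasDerivAt_t hΩ h).const_mul (m ^ 4))).deriv
  have ex : Dx (totalFluxX ε δ m w A) x y t = _ :=
    ((((S.smooth_A.mul s1).hasDerivAt_x hΩ h).fun_add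
      ((S.smooth_A.mul s2).hasDerivAt_x hΩ h)).fun_add
      (((S.smooth_A.mul hw).hasDerivAt_x hΩ h).const_mul (m ^ 4))).deriv
  have ey : Dy (totalFluxY ε δ m w b) x y t = _ :=
    (((n1.hasDerivAt_y hΩ h).fun_add (n2.hasDerivAt_y hΩ h)).fun_add
      ((((S.smooth_b.mul hw).sub ((hw.pow 2).mul (hw.dy hΩ))).hasDerivAt_y hΩ h).const_mul
        (m ^ 4))).deriv
  have d1 := S.divergence_density_le hm hε hε1 hδ hδD hx hy ht hwx (S.dx_A x hx' y hy' t ht')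
    (S.dx_b x hx' y hy' t ht') (S.dx_c x hx' y hy' t ht') (S.pde_dx hx hy ht)
  have d2 := S.divergence_density_le hm hε hε1 hδ hδD hx hy ht hwt (S.dt_A x hx' y hy' t ht')
    (S.dt_b x hx' y hy' t ht') (S.dt_c x hx' y hy' t ht') (S.pde_dt hx hy ht)
  have d3 := mul_le_mul_of_nonneg_left (S.divergence_mul_le hm hε hε1 hx hy ht)
    (show 0 ≤ m ^ 4 by positivity)
  have p1 := density_nonneg ε δ w (Dx w) x y t
  have p2 := density_nonneg ε δ w (Dt w) x y t
  have p3 := (S.pos _ h).le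
  have hmm : m ≤ m ^ 2 := le_self_pow₀ hm two_ne_zero
  have q1 := mul_le_mul_of_nonneg_right hmm p1
  have q2 := mul_le_mul_of_nonneg_right hmm p2
  dsimp only at p3
  have q3 : 0 ≤ m ^ 2 * (m ^ 4 * w x y t) := by positivity
  have q4 := mul_nonneg (sq_nonneg m) p2
  have r1 : (1:ℝ) ≤ m ^ 8 := one_le_pow₀ hm
  have r4 : m ^ 4 ≤ m ^ 8 := pow_le_pow_right₀ hm (by norm_num)
  have r5 : m ^ 5 ≤ m ^ 8 := pow_le_pow_right₀ hm (by norm_num)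
  have r6 : m ^ 6 ≤ m ^ 8 := pow_le_pow_right₀ hm (by norm_num)
  rw [et, ex, ey, totalDensity]
  linarith only [d1, d2, d3, q1, q2, q3, q4, r1, r4, r5, r6]

lemma normalFlux_bottom_le (S : ShiftedSolution L T ε m Ω w A b c) (hm : 1 ≤ m) (hε : 0 < ε)
    (hε1 : ε < 1) (hδ : 0 < δ) (hδ1 : δ ≤ 1) {z : ℝ → ℝ → ℝ → ℝ} {x t : ℝ}
    (hx : x ∈ Icc 0 L) (ht : t ∈ Icc 0 T)
    (hz : |Dy z x 0 t - z x 0 t * b x 0 t / w x 0 t ^ 2| ≤ 2 * m ^ 2) :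
    normalFlux ε δ w b z x 0 t ≤ 10 * m ^ 3 := by
  have hy : (0:ℝ) ∈ Icc (0:ℝ) 1 := ⟨le_rfl, zero_le_one⟩
  have hw0 := S.pos _ (S.subset (show (x, 0, t) ∈ closedBox L T from ⟨hx, hy, ht⟩))
  have hR := S.weight_div_le hm hε hx hy ht
  have hb := S.b_bottom x hx t ht
  have hb' := (le_abs_self _).trans (S.abs_b x hx 0 hy t ht)
  have hj := smoothAbs_pos hδ (z x 0 t)
  have hk := abs_div_smoothAbs_le hδ (z x 0 t)
  have hs0 := smoothAbs_sub_nonneg hδ (z x 0 t)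
  have hs := (smoothAbs_sub_le hδ (z x 0 t)).trans hδ1
  set e := Dy z x 0 t - z x 0 t * b x 0 t / w x 0 t ^ 2 with he
  have e1 : Dy z x 0 t = e + z x 0 t * b x 0 t / w x 0 t ^ 2 := by rw [he]; ring
  simp only [normalFlux, density, e1]
  generalize smoothAbs δ (z x 0 t) = j at *
  generalize z x 0 t = ζ at *
  generalize w x 0 t = v at *
  generalize b x 0 t = β at *
  simp only [sub_zero] at *
  have e2 : β * ((1 + ε) ^ 2 * j / v ^ 2)
        - (1 + ε) ^ 2 * (ζ * (e + ζ * β / v ^ 2) / j) - 2 * (1 + ε) * j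
      = β * ((1 + ε) ^ 2 / v ^ 2) * (j - ζ / j * ζ) + (1 + ε) ^ 2 * (-(ζ / j * e))
        - 2 * (1 + ε) * j := by
    field_simp; ring
  have b1 : β * ((1 + ε) ^ 2 / v ^ 2) * (j - ζ / j * ζ) ≤ 2 * m * m ^ 2 * 1 := by
    have : β ≤ 2 * m := by linarith only [hb']
    gcongr
  have b2 : -(ζ / j * e) ≤ 1 * (2 * m ^ 2) := by
    refine (neg_le_abs _).trans ?_
    rw [abs_mul]; gcongr
  have b3 : (1 + ε) ^ 2 * (-(ζ / j * e)) ≤ 2 ^ 2 * (1 * (2 * m ^ 2)) := by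
    refine (mul_le_mul_of_nonneg_left b2 (by positivity)).trans ?_
    gcongr; linarith only [hε1]
  have b4 : 0 ≤ 2 * (1 + ε) * j := by positivity
  have b5 : m ^ 2 ≤ m ^ 3 := pow_le_pow_right₀ hm (by norm_num)
  linarith only [e2, b1, b3, b4, b5]

lemma neg_normalFlux_top_le (S : ShiftedSolution L T ε m Ω w A b c)
    (hε1 : ε < 1) (hδ : 0 < δ) (hδ1 : δ ≤ 1) {z : ℝ → ℝ → ℝ → ℝ} {x t : ℝ}
    (hx : x ∈ Icc 0 L) (ht : t ∈ Icc 0 T) (hz : z x 1 t = 0) :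
    -normalFlux ε δ w b z x 1 t ≤ 2 := by
  have hb : b x 1 t = 0 := by
    have := S.abs_b x hx 1 ⟨zero_le_one, le_rfl⟩ t ht
    rw [sub_self, mul_zero] at this
    exact abs_nonpos_iff.1 this
  have hj : smoothAbs δ 0 ≤ 1 := by
    have := smoothAbs_le hδ 0
    rw [abs_zero] at this
    linarith only [this, hδ1]
  rw [normalFlux, hb, hz]
  simp only [sub_self, zero_mul, zero_div, mul_zero, zero_add, zero_sub, neg_neg]
  have := mul_le_mul hε1.le hj (smoothAbs_pos hδ 0).le zero_le_one
  linarith only [this]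

lemma totalFluxY_sub_le (S : ShiftedSolution L T ε m Ω w A b c) (hm : 1 ≤ m) (hε : 0 < ε)
    (hε1 : ε < 1) (hδ : 0 < δ) (hδ1 : δ ≤ 1) {x t : ℝ}
    (hx : x ∈ Icc 0 L) (ht : t ∈ Icc 0 T) :
    totalFluxY ε δ m w b x 0 t - totalFluxY ε δ m w b x 1 t ≤ 40 * m ^ 8 := by
  have hy : (0:ℝ) ∈ Icc (0:ℝ) 1 := ⟨le_rfl, zero_le_one⟩
  have hy1 : (1:ℝ) ∈ Icc (0:ℝ) 1 := ⟨zero_le_one, le_rfl⟩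
  have hw0 := S.pos _ (S.subset (show (x, 0, t) ∈ closedBox L T from ⟨hx, hy, ht⟩))
  have hb0 := S.b_bottom x hx t ht
  have hb' := (le_abs_self _).trans (S.abs_b x hx 0 hy t ht)
  have hb1 := S.abs_b x hx 1 hy1 t ht
  rw [sub_self, mul_zero] at hb1
  have hb1' : b x 1 t = 0 := abs_nonpos_iff.1 hb1
  have hw2 := S.w_le hm hε1 hx hy ht
  have n1 := S.normalFlux_bottom_le hm hε hε1 hδ hδ1 hx ht (S.dy_dx_bottom x hx t ht)
  have n2 := S.normalFlux_bottom_le hm hε hε1 hδ hδ1 hx ht (S.dy_dt_bottom x hx t ht)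
  have n3 := S.neg_normalFlux_top_le hε1 hδ hδ1 hx ht (S.dx_top x hx t ht)
  have n4 := S.neg_normalFlux_top_le hε1 hδ hδ1 hx ht (S.dt_top x hx t ht)
  have b1 : b x 0 t * w x 0 t ≤ 2 * m * (2 * m) := by
    have : b x 0 t ≤ 2 * m := by linarith only [hb']
    gcongr
  have b2 : w x 0 t ^ 2 * -Dy w x 0 t ≤ (2 * m) ^ 2 * (2 * m ^ 2) := by
    have h1 := (neg_le_abs _).trans (S.dy_bottom x hx t ht)
    refine (mul_le_mul_of_nonneg_left h1 (sq_nonneg _)).trans ?_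
    gcongr
  have b3 : w x 1 t ^ 2 * Dy w x 1 t ≤ 0 :=
    mul_nonpos_of_nonneg_of_nonpos (sq_nonneg _) (S.dy_top x hx t ht)
  have m4 : 0 ≤ m ^ 4 := by positivity
  have c1 := mul_le_mul_of_nonneg_left b1 m4
  have c2 := mul_le_mul_of_nonneg_left b2 m4
  have c3 := mul_le_mul_of_nonneg_left b3 m4
  have r1 : (1:ℝ) ≤ m ^ 8 := one_le_pow₀ hm
  have r3 : m ^ 3 ≤ m ^ 8 := pow_le_pow_right₀ hm (by norm_num)
  have r6 : m ^ 6 ≤ m ^ 8 := pow_le_pow_right₀ hm (by norm_num)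
  rw [totalFluxY, totalFluxY, hb1']
  linarith only [n1, n2, n3, n4, c1, c2, c3, r1, r3, r6]

lemma totalFluxX_sub_le (S : ShiftedSolution L T ε m Ω w A b c) (hL : 0 ≤ L) (hm : 1 ≤ m)
    (hε : 0 < ε) (hε1 : ε < 1) (hδ : 0 < δ) (hδ1 : δ ≤ 1) {y t : ℝ}
    (hy : y ∈ Icc (0:ℝ) 1) (ht : t ∈ Icc 0 T) :
    totalFluxX ε δ m w A 0 y t - totalFluxX ε δ m w A L y t ≤ 40 * m ^ 8 := by
  have hx0 : (0:ℝ) ∈ Icc 0 L := ⟨le_rfl, hL⟩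
  have hxL : L ∈ Icc 0 L := ⟨hL, le_rfl⟩
  have hA0 := S.A_nonneg 0 hx0 y hy t ht
  have hAL := S.A_nonneg L hxL y hy t ht
  have hA2 := S.A_le 0 hx0 y hy t ht
  have hw0 := S.pos _ (S.subset (show (0, y, t) ∈ closedBox L T from ⟨hx0, hy, ht⟩))
  have hwL := S.pos _ (S.subset (show (L, y, t) ∈ closedBox L T from ⟨hxL, hy, ht⟩))
  have hR := S.weight_div_le hm hε hx0 hy ht
  have hw2 := S.w_le hm hε1 hx0 hy ht
  have hfL : 0 ≤ totalFluxX ε δ m w A L y t := by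
    have p1 := density_nonneg ε δ w (Dx w) L y t
    have p2 := density_nonneg ε δ w (Dt w) L y t
    dsimp only at hwL
    rw [totalFluxX]; positivity
  have b1 : A 0 y t * density ε δ w (Dx w) 0 y t ≤ m ^ 2 * (12 * m ^ 3 + 2 * m * 1) := by
    rw [density_eq, mul_left_comm]
    have h1 := S.dx_inflow y hy t ht
    rw [abs_mul, abs_of_nonneg hA0] at h1
    have h2 := mul_le_mul_of_nonneg_left (smoothAbs_le hδ (Dx w 0 y t)) hA0
    have h3 : A 0 y t * δ ≤ 2 * m * 1 := by gcongr
    have h4 : A 0 y t * smoothAbs δ (Dx w 0 y t) ≤ 12 * m ^ 3 + 2 * m * 1 := by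
      linarith only [h1, h2, h3]
    have h5 := (smoothAbs_pos hδ (Dx w 0 y t)).le
    gcongr
  have b2 : A 0 y t * density ε δ w (Dt w) 0 y t ≤ 2 * m * (m ^ 2 * (m + 1)) := by
    have h1 := S.density_le hm hε hδ hδ1 hx0 hy ht (S.dt_inflow y hy t ht)
    have := density_nonneg ε δ w (Dt w) 0 y t
    gcongr
  have b3 : A 0 y t * w 0 y t ≤ 2 * m * (2 * m) := by
    gcongr
  have c3 := mul_le_mul_of_nonneg_left b3 (show 0 ≤ m ^ 4 by positivity)
  have r3 : m ^ 3 ≤ m ^ 8 := pow_le_pow_right₀ hm (by norm_num)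
  have r4 : m ^ 4 ≤ m ^ 8 := pow_le_pow_right₀ hm (by norm_num)
  have r5 : m ^ 5 ≤ m ^ 8 := pow_le_pow_right₀ hm (by norm_num)
  have r6 : m ^ 6 ≤ m ^ 8 := pow_le_pow_right₀ hm (by norm_num)
  have h0 : totalFluxX ε δ m w A 0 y t ≤ 40 * m ^ 8 := by
    rw [totalFluxX]
    have : 0 ≤ m ^ 8 := by positivity
    linarith only [b1, b2, c3, r3, r4, r5, r6, this]
  linarith only [h0, hfL]

lemma totalDensity_initial_le (S : ShiftedSolution L T ε m Ω w A b c) (hT : 0 ≤ T) (hm : 1 ≤ m)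
    (hε : 0 < ε) (hε1 : ε < 1) (hδ : 0 < δ) (hδ1 : δ ≤ 1) {x y : ℝ}
    (hx : x ∈ Icc 0 L) (hy : y ∈ Icc (0:ℝ) 1) :
    totalDensity ε δ m w x y 0 ≤ 40 * m ^ 8 := by
  have ht : (0:ℝ) ∈ Icc 0 T := ⟨le_rfl, hT⟩
  have b1 := S.density_le hm hε hδ hδ1 hx hy ht (S.dx_initial x hx y hy)
  have b2 := S.density_le hm hε hδ hδ1 hx hy ht (S.dt_initial x hx y hy)
  have b3 := mul_le_mul_of_nonneg_left (S.w_le hm hε1 hx hy ht) (show 0 ≤ m ^ 4 by positivity)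
  have r2 : m ^ 2 ≤ m ^ 8 := pow_le_pow_right₀ hm (by norm_num)
  have r3 : m ^ 3 ≤ m ^ 8 := pow_le_pow_right₀ hm (by norm_num)
  have r5 : m ^ 5 ≤ m ^ 8 := pow_le_pow_right₀ hm (by norm_num)
  have : 0 ≤ m ^ 8 := by positivity
  rw [totalDensity]
  linarith only [b1, b2, b3, r2, r3, r5, this]

/-- Bound for the `L¹` norm of the tangential gradient of a shifted solution. -/
def gradientConstant (L T m : ℝ) : ℝ :=
  m ^ 2 * (exp (18 * m ^ 2 * T) *
    (40 * m ^ 8 * (1 + T) * L + 40 * m ^ 8 * T * L + 40 * m ^ 8 * T))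

lemma continuous_slice {f : ℝ → ℝ → ℝ → ℝ} {t : ℝ} (hΩ : closedBox L T ⊆ Ω)
    (hf : SmoothOn Ω f) (ht : t ∈ Icc 0 T) :
    ContinuousOn (fun q : ℝ × ℝ => f q.1 q.2 t) (Icc 0 L ×ˢ Icc (0:ℝ) 1) :=
  (hf.continuousOn.mono hΩ).comp (f := fun q : ℝ × ℝ => (q.1, q.2, t)) (by fun_prop)
    fun _ hq => ⟨hq.1, hq.2, ht⟩

lemma lintegral_gradient_le (S : ShiftedSolution L T ε m Ω w A b c) (hL : 0 < L) (hT : 0 < T)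
    (hm : 1 ≤ m) (hε : 0 < ε) (hε1 : ε < 1) {t : ℝ} (ht : t ∈ Icc 0 T) :
    ∫⁻ q in (Ioo 0 L) ×ˢ (Ioo (0:ℝ) 1), ENNReal.ofReal (|Dx w q.1 q.2 t| + |Dt w q.1 q.2 t|)
      ≤ ENNReal.ofReal (gradientConstant L T m) := by
  obtain ⟨δ, hδ, hδ1, hδD⟩ := S.exists_regularization
  have key := integral_le_of_divergence_le_mul_add (B := 40 * m ^ 8) (k := 18 * m ^ 2) hL hT
    (by positivity) (by positivity) S.isOpen S.subset (S.smooth_totalDensity hδ)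
    (S.smooth_totalFluxX hδ) (S.smooth_totalFluxY hδ)
    (fun x hx y hy t ht => S.divergence_total_le hm hε hε1 hδ hδD hx hy ht)
    (fun y hy t ht => S.totalFluxX_sub_le hL.le hm hε hε1 hδ hδ1 hy ht)
    (fun x hx t ht => S.totalFluxY_sub_le hm hε hε1 hδ hδ1 hx ht)
    (fun x hx y hy => S.totalDensity_initial_le hT.le hm hε hε1 hδ hδ1 hx hy) t ht
  have hc := continuous_slice S.subset (S.smooth_totalDensity hδ) ht
  have hint : IntegrableOn (fun q : ℝ × ℝ => totalDensity ε δ m w q.1 q.2 t)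
      (Icc 0 L ×ˢ Icc (0:ℝ) 1) :=
    hc.integrableOn_compact (isCompact_Icc.prod isCompact_Icc)
  have hsub : Ioc 0 L ×ˢ Ioc (0:ℝ) 1 ⊆ Icc 0 L ×ˢ Icc (0:ℝ) 1 :=
    prod_mono Ioc_subset_Icc_self Ioc_subset_Icc_self
  have hint' := hint.mono_set hsub
  have hmeas : MeasurableSet (Ioc 0 L ×ˢ Ioc (0:ℝ) 1) := measurableSet_Ioc.prod measurableSet_Ioc
  have hm2 : 0 ≤ m ^ 2 := sq_nonneg m
  have hpos : ∀ q ∈ Ioc 0 L ×ˢ Ioc (0:ℝ) 1, 0 ≤ totalDensity ε δ m w q.1 q.2 t := by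
    intro q hq
    have hq' := hsub hq
    have h0 := (S.pos _ (S.subset (show (q.1, q.2, t) ∈ closedBox L T from
      ⟨hq'.1, hq'.2, ht⟩))).le
    have p1 := density_nonneg ε δ w (Dx w) q.1 q.2 t
    have p2 := density_nonneg ε δ w (Dt w) q.1 q.2 t
    dsimp only at h0
    rw [totalDensity]; positivity
  calc ∫⁻ q in (Ioo 0 L) ×ˢ (Ioo (0:ℝ) 1), ENNReal.ofReal (|Dx w q.1 q.2 t| + |Dt w q.1 q.2 t|)
      ≤ ∫⁻ q in (Ioc 0 L) ×ˢ (Ioc (0:ℝ) 1),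
          ENNReal.ofReal (|Dx w q.1 q.2 t| + |Dt w q.1 q.2 t|) :=
        lintegral_mono_set (prod_mono Ioo_subset_Ioc_self Ioo_subset_Ioc_self)
    _ ≤ ∫⁻ q in (Ioc 0 L) ×ˢ (Ioc (0:ℝ) 1),
          ENNReal.ofReal (m ^ 2 * totalDensity ε δ m w q.1 q.2 t) := by
        refine setLIntegral_mono' hmeas fun q hq => ENNReal.ofReal_le_ofReal ?_
        have hq' := hsub hq
        have h1 := S.abs_le_density hm hε δ (Dx w) hq'.1 hq'.2 ht
        have h2 := S.abs_le_density hm hε δ (Dt w) hq'.1 hq'.2 ht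
        have h0 := (S.pos _ (S.subset (show (q.1, q.2, t) ∈ closedBox L T from
          ⟨hq'.1, hq'.2, ht⟩))).le
        dsimp only at h0
        have h3 : 0 ≤ m ^ 2 * (m ^ 4 * w q.1 q.2 t) := by positivity
        rw [totalDensity]
        linarith only [h1, h2, h3]
    _ = ENNReal.ofReal (∫ q in (Ioc 0 L) ×ˢ (Ioc (0:ℝ) 1),
          m ^ 2 * totalDensity ε δ m w q.1 q.2 t) := by
        rw [ofReal_integral_eq_lintegral_ofReal (hint'.const_mul _)]
        exact (ae_restrict_iff' hmeas).2 (Filter.Eventually.of_forall fun q hq =>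
          mul_nonneg hm2 (hpos q hq))
    _ ≤ ENNReal.ofReal (gradientConstant L T m) := by
        refine ENNReal.ofReal_le_ofReal ?_
        rw [integral_const_mul, gradientConstant]
        refine mul_le_mul_of_nonneg_left ?_ hm2
        have e : ∫ q in (Ioc 0 L) ×ˢ (Ioc (0:ℝ) 1), totalDensity ε δ m w q.1 q.2 t
            = ∫ x in 0..L, ∫ y in 0..1, totalDensity ε δ m w x y t := by
          rw [intervalIntegral.integral_of_le hL.le]
          simp only [intervalIntegral.integral_of_le (zero_le_one' ℝ)]
          exact setIntegral_prod (μ := volume) (ν := volume) _ hint'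
        rw [e]
        exact key

end ShiftedSolution

lemma deriv_eq_of_eqOn_Icc {f g : ℝ → ℝ} {l r s : ℝ} (hlr : l < r) (hf : DifferentiableAt ℝ f s)
    (hg : DifferentiableAt ℝ g s) (h : ∀ z ∈ Icc l r, f z = g z) (hs : s ∈ Icc l r) :
    deriv f s = deriv g s := by
  have hu := uniqueDiffOn_Icc hlr s hs
  rw [← hf.derivWithin hu, ← hg.derivWithin hu]
  exact derivWithin_congr h (h s hs)

lemma deriv_nonpos_of_forall_Ioo_le {f : ℝ → ℝ} {f' l r : ℝ} (hlr : l < r)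
    (hf : HasDerivAt f f' r) (h : ∀ s ∈ Ioo l r, f r ≤ f s) : f' ≤ 0 := by
  have h1 := (hasDerivWithinAt_iff_tendsto_slope' (s := Iio r) (by simp)).1 hf.hasDerivWithinAt
  refine le_of_tendsto h1 ?_
  filter_upwards [Ioo_mem_nhdsLT hlr] with s hs
  rw [slope_def_field, div_nonpos_iff]
  left
  exact ⟨sub_nonneg.2 (h s hs), (sub_neg.2 hs.2).le⟩

namespace Smooth2

variable {f : ℝ → ℝ → ℝ}

lemma hasDerivAt_fderiv_fst (hf : Smooth2 f) (x t : ℝ) :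
    HasDerivAt (fun s => f s t) (fderiv ℝ (fun p : ℝ × ℝ => f p.1 p.2) (x, t) (1, 0)) x := by
  have h1 : HasDerivAt (fun s : ℝ => (s, t)) ((1 : ℝ), (0 : ℝ)) x :=
    (hasDerivAt_id x).prodMk (hasDerivAt_const x t)
  exact (ContDiff.differentiable hf (by simp) (x, t)).hasFDerivAt.comp_hasDerivAt x h1

lemma hasDerivAt_fderiv_snd (hf : Smooth2 f) (x t : ℝ) :
    HasDerivAt (fun s => f x s) (fderiv ℝ (fun p : ℝ × ℝ => f p.1 p.2) (x, t) (0, 1)) t := by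
  have h1 : HasDerivAt (fun s : ℝ => (x, s)) ((0 : ℝ), (1 : ℝ)) t :=
    (hasDerivAt_const t x).prodMk (hasDerivAt_id t)
  exact (ContDiff.differentiable hf (by simp) (x, t)).hasFDerivAt.comp_hasDerivAt t h1

lemma hasDerivAt_pd1 (hf : Smooth2 f) (x t : ℝ) : HasDerivAt (fun s => f s t) (pd1 f x t) x :=
  (hf.hasDerivAt_fderiv_fst x t).differentiableAt.hasDerivAt

lemma hasDerivAt_pd2 (hf : Smooth2 f) (x t : ℝ) : HasDerivAt (fun s => f x s) (pd2 f x t) t :=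
  (hf.hasDerivAt_fderiv_snd x t).differentiableAt.hasDerivAt

lemma fderiv_apply (hf : Smooth2 f) (v : ℝ × ℝ) :
    ContDiff ℝ ∞ (fun p => fderiv ℝ (fun p : ℝ × ℝ => f p.1 p.2) p v) :=
  (ContDiff.fderiv_right (m := ∞) hf (by simp)).clm_apply contDiff_const

lemma pd1 (hf : Smooth2 f) : Smooth2 (pd1 f) := by
  have : (fun p : ℝ × ℝ => _root_.pd1 f p.1 p.2)
      = fun p => fderiv ℝ (fun p : ℝ × ℝ => f p.1 p.2) p (1, 0) :=
    funext fun p => (hf.hasDerivAt_fderiv_fst p.1 p.2).deriv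
  rw [Smooth2, this]
  exact hf.fderiv_apply (1, 0)

lemma pd2 (hf : Smooth2 f) : Smooth2 (pd2 f) := by
  have : (fun p : ℝ × ℝ => _root_.pd2 f p.1 p.2)
      = fun p => fderiv ℝ (fun p : ℝ × ℝ => f p.1 p.2) p (0, 1) :=
    funext fun p => (hf.hasDerivAt_fderiv_snd p.1 p.2).deriv
  rw [Smooth2, this]
  exact hf.fderiv_apply (0, 1)

lemma smoothOn (hf : Smooth2 f) (Ω : Set (ℝ × ℝ × ℝ)) : SmoothOn Ω (fun x _ t => f x t) :=
  SmoothOn.of_contDiff (ContDiff.comp (g := fun p : ℝ × ℝ => f p.1 p.2) hf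
    (f := fun q : ℝ × ℝ × ℝ => (q.1, q.2.2)) (by fun_prop))

end Smooth2

/-- The structural constant of the shifted problem attached to the bound `M` of the data. -/
def structuralConstant (M : ℝ) : ℝ := 1 + M + M ^ 2 + M ^ 4

section coefficients

variable {m M : ℝ}

lemma abs_div_le_sq (hM : 0 < M) {α β : ℝ} (hα : |α| ≤ M) (hβ : M⁻¹ ≤ β) : |α / β| ≤ M ^ 2 := by
  have hβ0 : 0 < β := (inv_pos.2 hM).trans_le hβ
  have h1 : 1 ≤ M * β := by
    have := mul_le_mul_of_nonneg_left hβ hM.le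
    rwa [mul_inv_cancel₀ hM.ne'] at this
  rw [abs_div, abs_of_pos hβ0, div_le_iff₀ hβ0]
  have := mul_le_mul_of_nonneg_left h1 hM.le
  linarith only [this, hα]

lemma abs_quotient_deriv_le (hM : 0 < M) {α β α' β' : ℝ} (hα : |α| ≤ M) (hα' : |α'| ≤ M)
    (hβ' : |β'| ≤ M) (hβ : M⁻¹ ≤ β) : |(α' * β - α * β') / β ^ 2| ≤ M ^ 2 + M ^ 4 := by
  have hβ0 : β ≠ 0 := ((inv_pos.2 hM).trans_le hβ).ne'
  have e : (α' * β - α * β') / β ^ 2 = α' / β - α / β * (β' / β) := by field_simp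
  rw [e]
  refine (abs_sub _ _).trans ?_
  rw [abs_mul]
  have h1 := abs_div_le_sq hM hα' hβ
  have h2 := mul_le_mul (abs_div_le_sq hM hα hβ) (abs_div_le_sq hM hβ' hβ) (abs_nonneg _)
    (sq_nonneg M)
  linarith only [h1, h2]

lemma abs_affine_le {α β y : ℝ} (hα : |α| ≤ m) (hβ : |β| ≤ m) (hy : y ∈ Icc (0:ℝ) 1) :
    |y * α - β| ≤ 2 * m := by
  refine (abs_sub _ _).trans ?_
  rw [abs_mul, abs_of_nonneg hy.1]
  have := mul_le_of_le_one_left (abs_nonneg α) hy.2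
  linarith only [this, hα, hβ]

lemma one_sub_mem {y : ℝ} (hy : y ∈ Icc (0:ℝ) 1) : 1 - y ∈ Icc (0:ℝ) 1 :=
  ⟨by linarith only [hy.2], by linarith only [hy.1]⟩

lemma abs_one_sub_mul_le {α β y : ℝ} (hα : |α| ≤ m) (hβ : |β| ≤ m) (hy : y ∈ Icc (0:ℝ) 1) :
    |(1 - y) * (y * α - β)| ≤ 2 * m * (1 - y) := by
  have h0 := (one_sub_mem hy).1
  rw [abs_mul, abs_of_nonneg h0, mul_comm]
  gcongr
  exact abs_affine_le hα hβ hy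

lemma one_le_structuralConstant (hM : 0 < M) : 1 ≤ structuralConstant M := by
  have : 0 < M + M ^ 2 + M ^ 4 := by positivity
  rw [structuralConstant]; linarith only [this]

lemma le_structuralConstant (hM : 0 < M) : M ≤ structuralConstant M := by
  have : 0 < 1 + M ^ 2 + M ^ 4 := by positivity
  rw [structuralConstant]; linarith only [this]

lemma sq_add_le_structuralConstant (hM : 0 < M) : M ^ 2 + M ^ 4 ≤ structuralConstant M := by
  rw [structuralConstant]; linarith only [hM]

lemma sq_le_structuralConstant (hM : 0 < M) : M ^ 2 ≤ structuralConstant M := by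
  have : 0 < 1 + M + M ^ 4 := by positivity
  rw [structuralConstant]; linarith only [this]

end coefficients

/-- The coefficient of `∂_yu` after elimination of `∂ₜU` by the Bernoulli law. -/
def normalCoeff (U P : ℝ → ℝ → ℝ) (x y t : ℝ) : ℝ :=
  (1 - y) * (y * pd1 U x t - pd1 P x t / U x t)

namespace EulerData

variable {L T M : ℝ} {U P : ℝ → ℝ → ℝ} {x y t : ℝ}

lemma bcoef_eq (E : EulerData L T M U P) (hx : x ∈ Icc 0 L) (ht : t ∈ Icc 0 T) :
    bcoef U x y t = normalCoeff U P x y t := by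
  obtain ⟨-, -, hpos, hB, -⟩ := E
  have h1 := (hpos x hx t ht).ne'
  have h2 : pd2 U x t = -(U x t * pd1 U x t) - pd1 P x t := by linarith only [hB x hx t ht]
  rw [bcoef, normalCoeff, h2]
  field_simp
  ring

lemma abs_pd1_le (E : EulerData L T M U P) (hM : 0 < M) (hx : x ∈ Icc 0 L) (ht : t ∈ Icc 0 T) :
    |pd1 U x t| ≤ structuralConstant M :=
  (E.2.2.2.2.2.1 x hx t ht).2.1.trans (le_structuralConstant hM)

lemma abs_pd1_pd1_le (E : EulerData L T M U P) (hM : 0 < M) (hx : x ∈ Icc 0 L)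
    (ht : t ∈ Icc 0 T) : |pd1 (pd1 U) x t| ≤ structuralConstant M :=
  (E.2.2.2.2.2.1 x hx t ht).2.2.2.1.trans (le_structuralConstant hM)

lemma abs_pd2_pd1_le (E : EulerData L T M U P) (hM : 0 < M) (hx : x ∈ Icc 0 L)
    (ht : t ∈ Icc 0 T) : |pd2 (pd1 U) x t| ≤ structuralConstant M :=
  (E.2.2.2.2.2.1 x hx t ht).2.2.2.2.2.trans (le_structuralConstant hM)

lemma abs_pressure_le (E : EulerData L T M U P) (hM : 0 < M) (hx : x ∈ Icc 0 L)
    (ht : t ∈ Icc 0 T) : |pd1 P x t / U x t| ≤ structuralConstant M :=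
  (abs_div_le_sq hM (E.2.2.2.2.2.2.1 x hx t ht).2.1 (E.2.2.2.2.2.2.2 x hx t ht)).trans
    (sq_le_structuralConstant hM)

lemma exists_hasDerivAt_pressure_fst (E : EulerData L T M U P) (hM : 0 < M) (hx : x ∈ Icc 0 L)
    (ht : t ∈ Icc 0 T) : ∃ p', HasDerivAt (fun s => pd1 P s t / U s t) p' x ∧
      |p'| ≤ structuralConstant M := by
  obtain ⟨hU, hP, hpos, -, -, bU, bP, hlow⟩ := E
  refine ⟨_, (hP.pd1.hasDerivAt_pd1 x t).fun_div (hU.hasDerivAt_pd1 x t) (hpos x hx t ht).ne', ?_⟩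
  exact (abs_quotient_deriv_le hM (bP x hx t ht).2.1 (bP x hx t ht).2.2.2.1
    (bU x hx t ht).2.1 (hlow x hx t ht)).trans (sq_add_le_structuralConstant hM)

lemma exists_hasDerivAt_pressure_snd (E : EulerData L T M U P) (hM : 0 < M) (hx : x ∈ Icc 0 L)
    (ht : t ∈ Icc 0 T) : ∃ p', HasDerivAt (fun s => pd1 P x s / U x s) p' t ∧
      |p'| ≤ structuralConstant M := by
  obtain ⟨hU, hP, hpos, -, -, bU, bP, hlow⟩ := E
  refine ⟨_, (hP.pd1.hasDerivAt_pd2 x t).fun_div (hU.hasDerivAt_pd2 x t) (hpos x hx t ht).ne', ?_⟩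
  exact (abs_quotient_deriv_le hM (bP x hx t ht).2.1 (bP x hx t ht).2.2.2.2.2
    (bU x hx t ht).2.2.1 (hlow x hx t ht)).trans (sq_add_le_structuralConstant hM)

lemma abs_normalCoeff_le (E : EulerData L T M U P) (hM : 0 < M) (hx : x ∈ Icc 0 L)
    (hy : y ∈ Icc (0:ℝ) 1) (ht : t ∈ Icc 0 T) :
    |normalCoeff U P x y t| ≤ 2 * structuralConstant M * (1 - y) :=
  abs_one_sub_mul_le (E.abs_pd1_le hM hx ht) (E.abs_pressure_le hM hx ht) hy

lemma abs_dx_normalCoeff_le (E : EulerData L T M U P) (hM : 0 < M) (hx : x ∈ Icc 0 L)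
    (hy : y ∈ Icc (0:ℝ) 1) (ht : t ∈ Icc 0 T) :
    |Dx (normalCoeff U P) x y t| ≤ 2 * structuralConstant M * (1 - y) := by
  obtain ⟨p', hp, hp'⟩ := E.exists_hasDerivAt_pressure_fst hM hx ht
  have e : Dx (normalCoeff U P) x y t = _ :=
    ((((E.1.pd1.hasDerivAt_pd1 x t).const_mul y).fun_sub hp).const_mul (1 - y)).deriv
  rw [e]
  exact abs_one_sub_mul_le (E.abs_pd1_pd1_le hM hx ht) hp' hy

lemma abs_dt_normalCoeff_le (E : EulerData L T M U P) (hM : 0 < M) (hx : x ∈ Icc 0 L)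
    (hy : y ∈ Icc (0:ℝ) 1) (ht : t ∈ Icc 0 T) :
    |Dt (normalCoeff U P) x y t| ≤ 2 * structuralConstant M * (1 - y) := by
  obtain ⟨p', hp, hp'⟩ := E.exists_hasDerivAt_pressure_snd hM hx ht
  have e : Dt (normalCoeff U P) x y t = _ :=
    ((((E.1.pd1.hasDerivAt_pd2 x t).const_mul y).fun_sub hp).const_mul (1 - y)).deriv
  rw [e]
  exact abs_one_sub_mul_le (E.abs_pd2_pd1_le hM hx ht) hp' hy

lemma abs_dy_normalCoeff_le (E : EulerData L T M U P) (hM : 0 < M) (hx : x ∈ Icc 0 L)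
    (hy : y ∈ Icc (0:ℝ) 1) (ht : t ∈ Icc 0 T) :
    |Dy (normalCoeff U P) x y t| ≤ 3 * structuralConstant M := by
  have e : Dy (normalCoeff U P) x y t = _ :=
    (((hasDerivAt_id y).const_sub 1).fun_mul
      (((hasDerivAt_id y).mul_const (pd1 U x t)).sub_const (pd1 P x t / U x t))).deriv
  have h1 := abs_affine_le (E.abs_pd1_le hM hx ht) (E.abs_pressure_le hM hx ht) hy
  have h2 : |(1 - y) * pd1 U x t| ≤ structuralConstant M := by
    rw [abs_mul, abs_of_nonneg (one_sub_mem hy).1]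
    exact (mul_le_of_le_one_left (abs_nonneg _) (one_sub_mem hy).2).trans (E.abs_pd1_le hM hx ht)
  rw [e]
  simp only [id, neg_mul, one_mul]
  rw [neg_add_eq_sub]
  refine (abs_sub _ _).trans ?_
  linarith only [h1, h2]

lemma abs_ccoef_le (E : EulerData L T M U P) (hM : 0 < M) (hx : x ∈ Icc 0 L)
    (hy : y ∈ Icc (0:ℝ) 1) (ht : t ∈ Icc 0 T) :
    |ccoef U P x y t| ≤ 2 * structuralConstant M :=
  abs_affine_le (E.abs_pd1_le hM hx ht) (E.abs_pressure_le hM hx ht) (one_sub_mem hy)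

lemma abs_dx_ccoef_le (E : EulerData L T M U P) (hM : 0 < M) (hx : x ∈ Icc 0 L)
    (hy : y ∈ Icc (0:ℝ) 1) (ht : t ∈ Icc 0 T) :
    |Dx (ccoef U P) x y t| ≤ 2 * structuralConstant M := by
  obtain ⟨p', hp, hp'⟩ := E.exists_hasDerivAt_pressure_fst hM hx ht
  have e : Dx (ccoef U P) x y t = _ :=
    (((E.1.pd1.hasDerivAt_pd1 x t).const_mul (1 - y)).fun_sub hp).deriv
  rw [e]
  exact abs_affine_le (E.abs_pd1_pd1_le hM hx ht) hp' (one_sub_mem hy)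

lemma abs_dt_ccoef_le (E : EulerData L T M U P) (hM : 0 < M) (hx : x ∈ Icc 0 L)
    (hy : y ∈ Icc (0:ℝ) 1) (ht : t ∈ Icc 0 T) :
    |Dt (ccoef U P) x y t| ≤ 2 * structuralConstant M := by
  obtain ⟨p', hp, hp'⟩ := E.exists_hasDerivAt_pressure_snd hM hx ht
  have e : Dt (ccoef U P) x y t = _ :=
    (((E.1.pd1.hasDerivAt_pd2 x t).const_mul (1 - y)).fun_sub hp).deriv
  rw [e]
  exact abs_affine_le (E.abs_pd2_pd1_le hM hx ht) hp' (one_sub_mem hy)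

lemma normalCoeff_bottom (x t : ℝ) : normalCoeff U P x 0 t = -(pd1 P x t / U x t) := by
  rw [normalCoeff]; ring

lemma normalCoeff_bottom_nonneg (E : EulerData L T M U P) (hx : x ∈ Icc 0 L) (ht : t ∈ Icc 0 T) :
    0 ≤ normalCoeff U P x 0 t := by
  rw [normalCoeff_bottom]
  exact neg_nonneg.2 (div_nonpos_of_nonpos_of_nonneg (E.2.2.2.2.1 x hx t ht)
    (E.2.2.1 x hx t ht).le)

end EulerData

lemma SmoothOn.eq_on_closedBox {L T : ℝ} (hL : 0 < L) (hT : 0 < T) {Ω : Set (ℝ × ℝ × ℝ)}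
    (hΩ : closedBox L T ⊆ Ω) {f g : ℝ → ℝ → ℝ → ℝ} (hf : SmoothOn Ω f) (hg : SmoothOn Ω g)
    (h : ∀ x ∈ Ioo 0 L, ∀ y ∈ Ioo (0:ℝ) 1, ∀ t ∈ Ioo 0 T, f x y t = g x y t) :
    ∀ x ∈ Icc 0 L, ∀ y ∈ Icc (0:ℝ) 1, ∀ t ∈ Icc 0 T, f x y t = g x y t :=
  fun x hx y hy t ht => le_antisymm
    (hf.le_on_closedBox hL hT hΩ hg (fun x hx y hy t ht => (h x hx y hy t ht).le) x hx y hy t ht)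
    (hg.le_on_closedBox hL hT hΩ hf (fun x hx y hy t ht => (h x hx y hy t ht).ge) x hx y hy t ht)

/-- The Robin condition `w ∂_yw = v₀ w + p` differentiated along the boundary. -/
lemma abs_deriv_robin_le {m v' p p' ν ν' d : ℝ} (hm : 1 ≤ m) (hν : 1 ≤ m * ν) (hν0 : 0 < ν)
    (hv' : |v'| ≤ m) (hp' : |p'| ≤ m)
    (hd : d = v' + (p' * ν - p * ν') / ν ^ 2) :
    |d - ν' * -p / ν ^ 2| ≤ 2 * m ^ 2 := by
  have e : d - ν' * -p / ν ^ 2 = v' + p' / ν := by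
    rw [hd]; field_simp; ring
  have h1 : |p' / ν| ≤ m * m := by
    rw [abs_div, abs_of_pos hν0, div_le_iff₀ hν0]
    have := mul_le_mul hp' hν zero_le_one (by linarith only [hm])
    linarith only [this]
  have h2 : m ≤ m * m := le_mul_of_one_le_left (by linarith only [hm]) hm
  rw [e]
  refine (abs_add_le _ _).trans ?_
  linarith only [h1, h2, hv']

/-- Bound of one transport term from the equation and bounds of all the other terms. -/
lemma abs_le_of_equation {m τ σ β wy ν wyy γ v : ℝ} (hm : 1 ≤ m) (hσ : |σ| ≤ 2 * m ^ 2)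
    (hβ : |β| ≤ 2 * m) (hwy : |wy| ≤ m) (hν0 : 0 ≤ ν) (hν : ν ≤ 2 * m) (hwyy : |wyy| ≤ m)
    (hγ : |γ| ≤ 2 * m) (hv0 : 0 ≤ v) (hv : v ≤ 2 * m)
    (h : τ + σ + β * wy - ν ^ 2 * wyy + γ * v = 0) : |τ| ≤ 12 * m ^ 3 := by
  have e : τ = -σ + -(β * wy) + ν ^ 2 * wyy + -(γ * v) := by linarith only [h]
  have h1 : |β * wy| ≤ 2 * m * m := by rw [abs_mul]; gcongr
  have h2 : |ν ^ 2 * wyy| ≤ (2 * m) ^ 2 * m := by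
    rw [abs_mul, abs_of_nonneg (sq_nonneg ν)]; gcongr
  have h3 : |γ * v| ≤ 2 * m * (2 * m) := by
    rw [abs_mul, abs_of_nonneg hv0]; gcongr
  have h4 : m ^ 2 ≤ m ^ 3 := pow_le_pow_right₀ hm (by norm_num)
  rw [e]
  refine (abs_add_le _ _).trans ?_
  have h5 := abs_add_three (-σ) (-(β * wy)) (ν ^ 2 * wyy)
  rw [abs_neg, abs_neg] at h5
  rw [abs_neg]
  linarith only [h1, h2, h3, h4, h5, hσ]

/-- Where the shifted solution and the outer velocity are positive. -/
def positivitySet (ε : ℝ) (U : ℝ → ℝ → ℝ) (u : ℝ → ℝ → ℝ → ℝ) : Set (ℝ × ℝ × ℝ) :=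
  {q | 0 < u q.1 q.2.1 q.2.2 + ε} ∩ {q | 0 < U q.1 q.2.2}

lemma isOpen_positivitySet {ε : ℝ} {U : ℝ → ℝ → ℝ} {u : ℝ → ℝ → ℝ → ℝ} (hU : Smooth2 U)
    (hu : Smooth3 u) : IsOpen (positivitySet ε U u) := by
  refine IsOpen.inter ?_ ?_
  · exact isOpen_lt continuous_const ((ContDiff.continuous hu).add continuous_const)
  · exact isOpen_lt continuous_const ((ContDiff.continuous hU).comp
      (f := fun q : ℝ × ℝ × ℝ => (q.1, q.2.2)) (by fun_prop))

lemma shiftedSolution_of_regSolution {L T C₀ M ε C₁ : ℝ} (hL : 0 < L) (hT : 0 < T) (hM : 0 < M)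
    (hε : 0 < ε) (hε1 : ε < 1) {U P u₀ u₁ v₀ : ℝ → ℝ → ℝ} {u : ℝ → ℝ → ℝ → ℝ}
    (E : EulerData L T M U P) (D : DataBounds L T C₀ u₀ u₁ v₀)
    (B₀ : C2Bound u₀ (Icc 0 L) (Icc 0 1) M) (B₁ : C2Bound u₁ (Icc 0 1) (Icc 0 T) M)
    (Bv : C2Bound v₀ (Icc 0 L) (Icc 0 T) M) (R : RegSolution L T ε U P u₀ u₁ v₀ u)
    (hC₁ : 0 < C₁) (hC₁M : C₁ ≤ M)
    (hu : ∀ x ∈ Ioo 0 L, ∀ y ∈ Ioo (0:ℝ) 1, ∀ t ∈ Ioo 0 T,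
        C₁⁻¹ * (1 - y) ≤ u x y t ∧ u x y t ≤ C₁ * (1 - y)) :
    ShiftedSolution L T ε (structuralConstant M) (positivitySet ε U u)
      (fun x y t => u x y t + ε) (fun x y t => y * U x t + ε) (normalCoeff U P)
      (ccoef U P) := by
  obtain ⟨hu3, hpde, hu_init, hu_in, hu_top, hu_bot⟩ := R
  obtain ⟨hu₀, hu₁, hv₀, -, -, -⟩ := D
  have hU : Smooth2 U := E.1
  have hUpos := E.2.2.1
  have bU := E.2.2.2.2.2.1
  have hm := one_le_structuralConstant hM
  have hMm := le_structuralConstant hM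
  set m := structuralConstant M with hmdef
  have hm0 : 0 < m := one_pos.trans_le hm
  have hx0 : (0:ℝ) ∈ Icc 0 L := ⟨le_rfl, hL.le⟩
  have ht0 : (0:ℝ) ∈ Icc 0 T := ⟨le_rfl, hT.le⟩
  have hy0 : (0:ℝ) ∈ Icc (0:ℝ) 1 := ⟨le_rfl, zero_le_one⟩
  have hy1 : (1:ℝ) ∈ Icc (0:ℝ) 1 := ⟨zero_le_one, le_rfl⟩
  -- bounds of `u` on the closed cylinder
  have hlow : ∀ x ∈ Icc 0 L, ∀ y ∈ Icc (0:ℝ) 1, ∀ t ∈ Icc 0 T, C₁⁻¹ * (1 - y) ≤ u x y t :=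
    SmoothOn.le_on_closedBox hL hT (subset_univ _)
      (SmoothOn.of_contDiff (f := fun _ y _ => C₁⁻¹ * (1 - y)) (by fun_prop))
      (SmoothOn.of_contDiff hu3) fun x hx y hy t ht => (hu x hx y hy t ht).1
  have hup : ∀ x ∈ Icc 0 L, ∀ y ∈ Icc (0:ℝ) 1, ∀ t ∈ Icc 0 T, u x y t ≤ C₁ * (1 - y) :=
    SmoothOn.le_on_closedBox hL hT (subset_univ _) (SmoothOn.of_contDiff hu3)
      (SmoothOn.of_contDiff (f := fun _ y _ => C₁ * (1 - y)) (by fun_prop))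
      fun x hx y hy t ht => (hu x hx y hy t ht).2
  have hunn : ∀ x ∈ Icc 0 L, ∀ y ∈ Icc (0:ℝ) 1, ∀ t ∈ Icc 0 T, 0 ≤ u x y t :=
    fun x hx y hy t ht => le_trans
      (mul_nonneg (inv_nonneg.2 hC₁.le) (one_sub_mem hy).1) (hlow x hx y hy t ht)
  have lower : ∀ x ∈ Icc 0 L, ∀ y ∈ Icc (0:ℝ) 1, ∀ t ∈ Icc 0 T, 1 - y ≤ m * u x y t := by
    intro x hx y hy t ht
    have h1 := mul_le_mul_of_nonneg_left (hlow x hx y hy t ht) hC₁.le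
    rw [← mul_assoc, mul_inv_cancel₀ hC₁.ne', one_mul] at h1
    exact h1.trans (mul_le_mul_of_nonneg_right (hC₁M.trans hMm) (hunn x hx y hy t ht))
  have upper : ∀ x ∈ Icc 0 L, ∀ y ∈ Icc (0:ℝ) 1, ∀ t ∈ Icc 0 T, u x y t ≤ m * (1 - y) :=
    fun x hx y hy t ht => (hup x hx y hy t ht).trans
      (mul_le_mul_of_nonneg_right (hC₁M.trans hMm) (one_sub_mem hy).1)
  have hum : ∀ x ∈ Icc 0 L, ∀ y ∈ Icc (0:ℝ) 1, ∀ t ∈ Icc 0 T, u x y t ≤ m := by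
    intro x hx y hy t ht
    exact (upper x hx y hy t ht).trans (mul_le_of_le_one_right hm0.le (one_sub_mem hy).2)
  -- smoothness
  set Ω := positivitySet ε U u with hΩdef
  have hΩ : IsOpen Ω := isOpen_positivitySet hU hu3
  have hsub : closedBox L T ⊆ Ω := fun q hq =>
    ⟨add_pos_of_nonneg_of_pos (hunn _ hq.1 _ hq.2.1 _ hq.2.2) hε, hUpos _ hq.1 _ hq.2.2⟩
  set w : ℝ → ℝ → ℝ → ℝ := fun x y t => u x y t + ε with hwdef
  have hs : SmoothOn Ω u := SmoothOn.of_contDiff hu3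
  have hw : SmoothOn Ω w := hs.add (SmoothOn.const ε)
  have hsA : SmoothOn Ω (fun x y t => y * U x t + ε) :=
    ((SmoothOn.of_contDiff (f := fun _ y _ => y) (by fun_prop)).mul (hU.smoothOn Ω)).add
      (SmoothOn.const ε)
  have hsp : SmoothOn Ω (fun x _ t => pd1 P x t / U x t) :=
    (E.2.1.pd1.smoothOn Ω).div (hU.smoothOn Ω) fun q hq => ne_of_gt hq.2
  have hsb : SmoothOn Ω (normalCoeff U P) :=
    (SmoothOn.of_contDiff (f := fun _ y _ => 1 - y) (by fun_prop)).mul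
      (((SmoothOn.of_contDiff (f := fun _ y _ => y) (by fun_prop)).mul
        (hU.pd1.smoothOn Ω)).sub hsp)
  have hsc : SmoothOn Ω (ccoef U P) :=
    ((SmoothOn.of_contDiff (f := fun _ y _ => 1 - y) (by fun_prop)).mul
      (hU.pd1.smoothOn Ω)).sub hsp
  have ex : Dx w = Dx u := by funext x y t; exact deriv_add_const (f := fun s => u s y t) ε
  have ey : Dy w = Dy u := by funext x y t; exact deriv_add_const (f := fun s => u x s t) ε
  have et : Dt w = Dt u := by funext x y t; exact deriv_add_const (f := fun s => u x y s) ε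
  -- the equation
  have pde : ∀ x ∈ Ioo 0 L, ∀ y ∈ Ioo (0:ℝ) 1, ∀ t ∈ Ioo 0 T,
      Dt w x y t + (y * U x t + ε) * Dx w x y t + normalCoeff U P x y t * Dy w x y t
        - w x y t ^ 2 * Dy (Dy w) x y t + ccoef U P x y t * (w x y t - ε) = 0 := by
    intro x hx y hy t ht
    have h1 := hpde x hx y hy t ht
    rw [E.bcoef_eq (Ioo_subset_Icc_self hx) (Ioo_subset_Icc_self ht)] at h1
    have h2 : Dyy u x y t = Dy (Dy u) x y t := by
      rw [Dyy, iteratedDeriv_succ, iteratedDeriv_one]; rfl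
    rw [h2] at h1
    rw [ex, ey, et]
    simp only [hwdef, add_sub_cancel_right]
    linarith only [h1]
  have pde' : ∀ x ∈ Icc 0 L, ∀ y ∈ Icc (0:ℝ) 1, ∀ t ∈ Icc 0 T,
      Dt w x y t + (y * U x t + ε) * Dx w x y t + normalCoeff U P x y t * Dy w x y t
        - w x y t ^ 2 * Dy (Dy w) x y t + ccoef U P x y t * (w x y t - ε) = 0 :=
    SmoothOn.eq_on_closedBox hL hT hsub
      (((((hw.dt hΩ).add (hsA.mul (hw.dx hΩ))).add (hsb.mul (hw.dy hΩ))).sub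
        ((hw.pow 2).mul ((hw.dy hΩ).dy hΩ))).add (hsc.mul (hw.sub (SmoothOn.const ε))))
      (SmoothOn.const 0) pde
  have mem : ∀ {x y t : ℝ}, x ∈ Icc 0 L → y ∈ Icc (0:ℝ) 1 → t ∈ Icc 0 T → (x, y, t) ∈ Ω :=
    fun hx hy ht => hsub ⟨hx, hy, ht⟩
  have hwm : ∀ x ∈ Icc 0 L, ∀ y ∈ Icc (0:ℝ) 1, ∀ t ∈ Icc 0 T, w x y t ≤ 2 * m :=
    fun x hx y hy t ht => by
      have := hum x hx y hy t ht
      simp only [hwdef]; linarith only [this, hm, hε1]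
  have hwpos : ∀ x ∈ Icc 0 L, ∀ y ∈ Icc (0:ℝ) 1, ∀ t ∈ Icc 0 T, 0 < w x y t :=
    fun x hx y hy t ht => (hsub (show (x, y, t) ∈ closedBox L T from ⟨hx, hy, ht⟩)).1
  -- the coefficients
  have A_nonneg : ∀ x ∈ Icc 0 L, ∀ y ∈ Icc (0:ℝ) 1, ∀ t ∈ Icc 0 T, 0 ≤ y * U x t + ε :=
    fun x hx y hy t ht => add_nonneg (mul_nonneg hy.1 (hUpos x hx t ht).le) hε.le
  have A_le : ∀ x ∈ Icc 0 L, ∀ y ∈ Icc (0:ℝ) 1, ∀ t ∈ Icc 0 T, y * U x t + ε ≤ 2 * m := by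
    intro x hx y hy t ht
    have h1 := mul_le_of_le_one_left (hUpos x hx t ht).le hy.2
    have h2 := (le_abs_self _).trans (bU x hx t ht).1
    linarith only [h1, h2, hMm, hm, hε1]
  have b_le : ∀ x ∈ Icc 0 L, ∀ y ∈ Icc (0:ℝ) 1, ∀ t ∈ Icc 0 T,
      |normalCoeff U P x y t| ≤ 2 * m := fun x hx y hy t ht =>
    (E.abs_normalCoeff_le hM hx hy ht).trans
      (mul_le_of_le_one_right (by positivity) (one_sub_mem hy).2)
  -- the Robin condition
  have hν : ∀ x ∈ Icc 0 L, ∀ t ∈ Icc 0 T, 1 ≤ m * w x 0 t := by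
    intro x hx t ht
    have h1 := lower x hx 0 hy0 t ht
    have h2 : 0 < m * ε := by positivity
    simp only [hwdef]
    linarith only [h1, h2]
  have robin : ∀ x ∈ Icc 0 L, ∀ t ∈ Icc 0 T,
      Dy w x 0 t = v₀ x t + pd1 P x t / U x t / w x 0 t := by
    intro x hx t ht
    have h1 := hu_bot x hx t ht
    have h2 : w x 0 t ≠ 0 := (hwpos x hx 0 hy0 t ht).ne'
    rw [ey]
    apply mul_left_cancel₀ h2
    rw [mul_add, mul_div_cancel₀ _ h2]
    simp only [hwdef]
    linarith only [h1]
  refine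
    { isOpen := hΩ
      subset := hsub
      smooth_w := hw
      smooth_A := hsA
      smooth_b := hsb
      smooth_c := hsc
      pos := fun q hq => hq.1
      pde := pde
      lower := fun x hx y hy t ht => by
        simpa only [hwdef, add_sub_cancel_right] using lower x hx y hy t ht
      upper := fun x hx y hy t ht => by
        simpa only [hwdef, add_sub_cancel_right] using upper x hx y hy t ht
      A_nonneg := A_nonneg
      A_le := A_le
      dx_A := ?_
      dt_A := ?_
      abs_b := fun x hx y hy t ht => E.abs_normalCoeff_le hM hx hy ht
      dx_b := fun x hx y hy t ht => E.abs_dx_normalCoeff_le hM hx hy ht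
      dy_b := fun x hx y hy t ht => E.abs_dy_normalCoeff_le hM hx hy ht
      dt_b := fun x hx y hy t ht => E.abs_dt_normalCoeff_le hM hx hy ht
      abs_c := fun x hx y hy t ht => E.abs_ccoef_le hM hx hy ht
      dx_c := fun x hx y hy t ht => E.abs_dx_ccoef_le hM hx hy ht
      dt_c := fun x hx y hy t ht => E.abs_dt_ccoef_le hM hx hy ht
      b_bottom := fun x hx t ht => E.normalCoeff_bottom_nonneg hx ht
      dy_bottom := ?_
      dy_dx_bottom := ?_
      dy_dt_bottom := ?_
      dx_top := ?_
      dt_top := ?_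
      dy_top := ?_
      dt_inflow := ?_
      dx_inflow := ?_
      dx_initial := ?_
      dt_initial := ?_ }
  · intro x hx y hy t ht
    have e : Dx (fun x y t => y * U x t + ε) x y t = _ :=
      (((hU.hasDerivAt_pd1 x t).const_mul y).add_const ε).deriv
    rw [e, abs_mul, abs_of_nonneg hy.1]
    exact (mul_le_of_le_one_left (abs_nonneg _) hy.2).trans (E.abs_pd1_le hM hx ht)
  · intro x hx y hy t ht
    have e : Dt (fun x y t => y * U x t + ε) x y t = _ :=
      (((hU.hasDerivAt_pd2 x t).const_mul y).add_const ε).deriv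
    rw [e, abs_mul, abs_of_nonneg hy.1]
    exact (mul_le_of_le_one_left (abs_nonneg _) hy.2).trans ((bU x hx t ht).2.2.1.trans hMm)
  · intro x hx t ht
    have h1 : |pd1 P x t / U x t / w x 0 t| ≤ m * m := by
      have h0 := hwpos x hx 0 hy0 t ht
      rw [abs_div, abs_of_pos h0, div_le_iff₀ h0]
      have := mul_le_mul (E.abs_pressure_le hM hx ht) (hν x hx t ht) zero_le_one hm0.le
      linarith only [this]
    have h2 : m ≤ m * m := le_mul_of_one_le_left hm0.le hm
    have h3 := (Bv x hx t ht).1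
    rw [robin x hx t ht]
    refine (abs_add_le _ _).trans ?_
    linarith only [h1, h2, h3, hMm]
  · intro x hx t ht
    obtain ⟨p', hp, hp'⟩ := E.exists_hasDerivAt_pressure_fst hM hx ht
    have hq := mem hx hy0 ht
    have h0 := hwpos x hx 0 hy0 t ht
    have hg := (hv₀.hasDerivAt_pd1 x t).fun_add (hp.fun_div (hw.hasDerivAt_x hΩ hq) h0.ne')
    have e : Dx (Dy w) x 0 t = _ :=
      (deriv_eq_of_eqOn_Icc hL ((hw.dy hΩ).hasDerivAt_x hΩ hq).differentiableAt
        hg.differentiableAt (fun s hs => robin s hs t ht) hx).trans hg.deriv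
    rw [EulerData.normalCoeff_bottom, hw.dy_dx_comm hΩ hq]
    exact abs_deriv_robin_le hm (hν x hx t ht) h0 ((Bv x hx t ht).2.1.trans hMm) hp' e
  · intro x hx t ht
    obtain ⟨p', hp, hp'⟩ := E.exists_hasDerivAt_pressure_snd hM hx ht
    have hq := mem hx hy0 ht
    have h0 := hwpos x hx 0 hy0 t ht
    have hg := (hv₀.hasDerivAt_pd2 x t).fun_add (hp.fun_div (hw.hasDerivAt_t hΩ hq) h0.ne')
    have e : Dt (Dy w) x 0 t = _ :=
      (deriv_eq_of_eqOn_Icc hT ((hw.dy hΩ).hasDerivAt_t hΩ hq).differentiableAt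
        hg.differentiableAt (fun s hs => robin x hx s hs) ht).trans hg.deriv
    rw [EulerData.normalCoeff_bottom, hw.dy_dt_comm hΩ hq]
    exact abs_deriv_robin_le hm (hν x hx t ht) h0 ((Bv x hx t ht).2.2.1.trans hMm) hp' e
  · intro x hx t ht
    rw [ex]
    exact (deriv_eq_of_eqOn_Icc hL (hs.hasDerivAt_x hΩ (mem hx hy1 ht)).differentiableAt
      (differentiableAt_const 0) (fun s hs => hu_top s hs t ht) hx).trans (deriv_const x 0)
  · intro x hx t ht
    rw [et]
    exact (deriv_eq_of_eqOn_Icc hT (hs.hasDerivAt_t hΩ (mem hx hy1 ht)).differentiableAt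
      (differentiableAt_const 0) (fun s hs => hu_top x hx s hs) ht).trans (deriv_const t 0)
  · intro x hx t ht
    rw [ey]
    refine deriv_nonpos_of_forall_Ioo_le zero_lt_one (hs.hasDerivAt_y hΩ (mem hx hy1 ht)) ?_
    intro s hs
    rw [hu_top x hx t ht]
    exact hunn x hx s (Ioo_subset_Icc_self hs) t ht
  · intro y hy t ht
    have e : Dt u 0 y t = pd2 u₁ y t :=
      deriv_eq_of_eqOn_Icc hT (hs.hasDerivAt_t hΩ (mem hx0 hy ht)).differentiableAt
        (hu₁.hasDerivAt_pd2 y t).differentiableAt (fun s hs => hu_in y hy s hs) ht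
    rw [et, e]
    exact (B₁ y hy t ht).2.2.1.trans hMm
  · intro y hy t ht
    have e : Dt u 0 y t = pd2 u₁ y t :=
      deriv_eq_of_eqOn_Icc hT (hs.hasDerivAt_t hΩ (mem hx0 hy ht)).differentiableAt
        (hu₁.hasDerivAt_pd2 y t).differentiableAt (fun s hs => hu_in y hy s hs) ht
    have e1 : ∀ y ∈ Icc (0:ℝ) 1, Dy u 0 y t = pd1 u₁ y t := fun y hy =>
      deriv_eq_of_eqOn_Icc zero_lt_one (hs.hasDerivAt_y hΩ (mem hx0 hy ht)).differentiableAt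
        (hu₁.hasDerivAt_pd1 y t).differentiableAt (fun s hs => hu_in s hs t ht) hy
    have e2 : Dy (Dy u) 0 y t = pd1 (pd1 u₁) y t :=
      deriv_eq_of_eqOn_Icc zero_lt_one
        ((hs.dy hΩ).hasDerivAt_y hΩ (mem hx0 hy ht)).differentiableAt
        (hu₁.pd1.hasDerivAt_pd1 y t).differentiableAt e1 hy
    have b1 := B₁ y hy t ht
    have h1 := pde' 0 hx0 y hy t ht
    rw [et, ey, e, e1 y hy, e2] at h1
    have h2 : |pd2 u₁ y t| ≤ 2 * m ^ 2 := by
      have := le_self_pow₀ hm two_ne_zero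
      linarith only [b1.2.2.1, hMm, this, hm0]
    refine abs_le_of_equation hm h2 (b_le 0 hx0 y hy t ht) (b1.2.1.trans hMm)
      (hwpos 0 hx0 y hy t ht).le (hwm 0 hx0 y hy t ht) (b1.2.2.2.1.trans hMm)
      (E.abs_ccoef_le hM hx0 hy ht) (hunn 0 hx0 y hy t ht)
      ((hum 0 hx0 y hy t ht).trans (by linarith only [hm0])) ?_
    simp only [hwdef, add_sub_cancel_right] at h1 ⊢
    linarith only [h1]
  · intro x hx y hy
    have e : Dx u x y 0 = pd1 u₀ x y :=
      deriv_eq_of_eqOn_Icc hL (hs.hasDerivAt_x hΩ (mem hx hy ht0)).differentiableAt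
        (hu₀.hasDerivAt_pd1 x y).differentiableAt (fun s hs => hu_init s hs y hy) hx
    rw [ex, e]
    exact (B₀ x hx y hy).2.1.trans hMm
  · intro x hx y hy
    have e : Dx u x y 0 = pd1 u₀ x y :=
      deriv_eq_of_eqOn_Icc hL (hs.hasDerivAt_x hΩ (mem hx hy ht0)).differentiableAt
        (hu₀.hasDerivAt_pd1 x y).differentiableAt (fun s hs => hu_init s hs y hy) hx
    have e1 : ∀ y ∈ Icc (0:ℝ) 1, Dy u x y 0 = pd2 u₀ x y := fun y hy =>
      deriv_eq_of_eqOn_Icc zero_lt_one (hs.hasDerivAt_y hΩ (mem hx hy ht0)).differentiableAt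
        (hu₀.hasDerivAt_pd2 x y).differentiableAt (fun s hs => hu_init x hx s hs) hy
    have e2 : Dy (Dy u) x y 0 = pd2 (pd2 u₀) x y :=
      deriv_eq_of_eqOn_Icc zero_lt_one
        ((hs.dy hΩ).hasDerivAt_y hΩ (mem hx hy ht0)).differentiableAt
        (hu₀.pd2.hasDerivAt_pd2 x y).differentiableAt e1 hy
    have b0 := B₀ x hx y hy
    have h1 := pde' x hx y hy 0 ht0
    rw [ex, ey, e, e1 y hy, e2] at h1
    have h2 : |(y * U x 0 + ε) * pd1 u₀ x y| ≤ 2 * m ^ 2 := by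
      rw [abs_mul, abs_of_nonneg (A_nonneg x hx y hy 0 ht0)]
      have := mul_le_mul (A_le x hx y hy 0 ht0) (b0.2.1.trans hMm) (abs_nonneg _) (by positivity)
      linarith only [this]
    refine abs_le_of_equation hm h2 (b_le x hx y hy 0 ht0) (b0.2.2.1.trans hMm)
      (hwpos x hx y hy 0 ht0).le (hwm x hx y hy 0 ht0) (b0.2.2.2.2.1.trans hMm)
      (E.abs_ccoef_le hM hx hy ht0) (hunn x hx y hy 0 ht0)
      ((hum x hx y hy 0 ht0).trans (by linarith only [hm0])) ?_
    simp only [hwdef, add_sub_cancel_right] at h1 ⊢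
    linarith only [h1]

/-- Lemma 2.5: uniform-in-time `L¹` bound on the tangential gradient `(∂_x u, ∂_t u)`
of the regularized solutions. -/
theorem tangential_gradient_bound (L T C₀ M : ℝ)
    (hL : 0 < L) (hT : 0 < T) (hC₀ : 0 < C₀) (hM : 0 < M) :
    ∃ C₄ > (0:ℝ), ∀ ε ∈ Ioo (0:ℝ) 1, ∀ U P : ℝ → ℝ → ℝ, ∀ u₀ u₁ v₀ : ℝ → ℝ → ℝ,
      ∀ u : ℝ → ℝ → ℝ → ℝ, ∀ C₁ : ℝ,
      EulerData L T M U P →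
      DataBounds L T C₀ u₀ u₁ v₀ →
      C2Bound u₀ (Icc 0 L) (Icc 0 1) M →
      C2Bound u₁ (Icc 0 1) (Icc 0 T) M →
      C2Bound v₀ (Icc 0 L) (Icc 0 T) M →
      RegSolution L T ε U P u₀ u₁ v₀ u →
      0 < C₁ → C₁ ≤ M →
      (∀ x ∈ Ioo 0 L, ∀ y ∈ Ioo (0:ℝ) 1, ∀ t ∈ Ioo 0 T,
        C₁⁻¹ * (1 - y) ≤ u x y t ∧ u x y t ≤ C₁ * (1 - y)) →
      ∀ t ∈ Icc 0 T,
        ∫⁻ q in (Ioo 0 L) ×ˢ (Ioo (0:ℝ) 1),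
            ENNReal.ofReal (|Dx u q.1 q.2 t| + |Dt u q.1 q.2 t|)
          ≤ ENNReal.ofReal C₄ := by
  have hm := one_le_structuralConstant hM
  have hm0 : 0 < structuralConstant M := by linarith
  refine ⟨ShiftedSolution.gradientConstant L T (structuralConstant M), ?_, ?_⟩
  · unfold ShiftedSolution.gradientConstant
    positivity
  · intro ε hε U P u₀ u₁ v₀ u C₁ E D B₀ B₁ Bv R hC₁ hC₁M hu t ht
    have S := shiftedSolution_of_regSolution hL hT hM hε.1 hε.2 E D B₀ B₁ Bv R hC₁ hC₁M hu
    have key := S.lintegral_gradient_le hL hT hm hε.1 hε.2 ht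
    have ex : Dx (fun x y t => u x y t + ε) = Dx u := by
      funext x y t
      exact deriv_add_const (f := fun s => u s y t) ε
    have et : Dt (fun x y t => u x y t + ε) = Dt u := by
      funext x y t
      exact deriv_add_const (f := fun s => u x y s) ε
    rw [ex, et] at key
    exact key

end
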